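/- arXiv:1511.01175 — 2 statements merged into one kernel-verified Lean document; each statement's English description precedes it below -/
import Mathlib

section
/- Let n and d be integers with d ≥ 2 and dn even, let γ > 0 be a constant, set i1 = ⌊(1+γ)(d−1)²/4⌋, and assume i1 ≥ 1. Let ε be a real number satisfying 4(1+γ)(d−1)²(d−2)(d−3) / ( dn·(dn − 7d² + 7d − 10 − 4γ(d−1)²) ) ≤ ε < 1, and assume dn − 7d² + 7d − 10 − 4γ(d−1)² > 0. Then there exists a unique tuple of real numbers (x_0, …, x_{i1}, ρ_I(0), …, ρ_I(i1), ρ_II(0), …, ρ_II(i1)) with x_j > 0 for all j, satisfying: ρ_I(i) = 1 − ε for all 1 ≤ i ≤ i1; ρ_I(0) = ρ_II(0) = 0 and ρ_II(i1) = 0; x_j = 1 + x_{j+1}·ρ_I(j+1)·m̲_A(j)/m̄_I(j+1) + x_j·ρ_I(j)·m̲_B(j)/m̄_I(j) for all 1 ≤ j ≤ i1 − 1; x_{i1} = 1 + x_{i1}·ρ_I(i1)·m̲_B(i1)/m̄_I(i1); x_0 = 1 + x_1·ρ_I(1)·m̲_A(0)/m̄_I(1); and ρ_II(j) = ρ_I(j+1)·(x_{j+1}/x_j)·(m̄_II(j)/m̄_I(j+1))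 for all 0 ≤ j ≤ i1 − 1. Moreover, this unique solution satisfies ρ_I(i) ≥ 0, ρ_II(i) ≥ 0 and ρ_I(i) + ρ_II(i) ≤ 1 for all 0 ≤ i ≤ i1. -/
/-!
Formalization of the pairing model of random `d`-regular (multi)graphs and of the
switchings used in the uniform sampler *REG* of Gao and Wormald,
"Uniform generation of random regular graphs".

Bins are elements of `Fin n`; each bin contains `d` points, so points are
elements of `Fin n × Fin d`.  A pairing is a perfect matching of the points,
modelled as a fixed-point-free involution on the points: the pairs of the
pairing are the orbits `{x, P.f x}`.
-/

namespace Reg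

abbrev Point (n d : ℕ) := Fin n × Fin d

/-- A pairing: a perfect matching of the `d * n` points, encoded as a
fixed-point-free involution.  The pairs are the 2-element sets `{x, f x}`. -/
structure Pairing (n d : ℕ) where
  f : Point n d → Point n d
  invol : ∀ x, f (f x) = x
  nofix : ∀ x, f x ≠ x

instance {n d : ℕ} : Finite (Pairing n d) :=
  Finite.of_injective (fun P => P.f) fun P Q h => by
    cases P; cases Q; congr

variable {n d : ℕ}

/-- The number of pairs of `P` with one point in bin `u` and one point in bin `v`
(for distinct bins `u ≠ v` this is the multiplicity of the edge `uv`). -/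
def mult (P : Pairing n d) (u v : Fin n) : ℕ :=
  (Finset.univ.filter fun a : Point n d => a.1 = u ∧ (P.f a).1 = v).card

/-- Two bins are adjacent if some pair of the pairing joins them. -/
def Adj (P : Pairing n d) (u v : Fin n) : Prop := u ≠ v ∧ 1 ≤ mult P u v

/-- The number of loops of `P` (pairs whose two points lie in the same bin). -/
def numLoops (P : Pairing n d) : ℕ :=
  (Finset.univ.filter fun a : Point n d => (P.f a).1 = a.1).card / 2

/-- The number of loops of `P` lying in bin `u`. -/
def loopsAt (P : Pairing n d) (u : Fin n) : ℕ :=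
  (Finset.univ.filter fun a : Point n d => a.1 = u ∧ (P.f a).1 = u).card / 2

/-- The number of (unordered) pairs of distinct bins joined by exactly `k` pairs of `P`,
i.e. the number of edges of multiplicity exactly `k`. -/
def edgesWithMult (P : Pairing n d) (k : ℕ) : ℕ :=
  (Finset.univ.filter fun q : Fin n × Fin n => q.1 < q.2 ∧ mult P q.1 q.2 = k).card

/-- `M1 = dn` as a real number. -/
noncomputable def M1R (n d : ℕ) : ℝ := (d : ℝ) * n

/-- `M2 = n d (d-1)` as a real number. -/
noncomputable def M2R (n d : ℕ) : ℝ := (n : ℝ) * d * ((d : ℝ) - 1)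

/-- `M3 = n d (d-1) (d-2)` as a real number. -/
noncomputable def M3R (n d : ℕ) : ℝ := (n : ℝ) * d * ((d : ℝ) - 1) * ((d : ℝ) - 2)

/-- `i1 = ⌊(1+γ)(d-1)²/4⌋`. -/
noncomputable def i1Nat (d : ℕ) (γ : ℝ) : ℕ := (⌊(1 + γ) * ((d : ℝ) - 1) ^ 2 / 4⌋).toNat

/-- The stratum `S_i` of the double-edge reduction phase: pairings with no loops,
every edge of multiplicity at most 2, and exactly `i` double edges. -/
def SD (n d i : ℕ) : Set (Pairing n d) :=
  {P | numLoops P = 0 ∧ (∀ u v : Fin n, u ≠ v → mult P u v ≤ 2) ∧ edgesWithMult P 2 = i}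

/-- `Φ1 = ⋃_{0 ≤ i ≤ m} S_i`. -/
def Phi1 (n d m : ℕ) : Set (Pairing n d) := {P | ∃ i ≤ m, P ∈ SD n d i}

/-- The labelled data (points 1–8) of a d-switching. -/
structure DSwitch (n d : ℕ) where
  p1 : Point n d
  p2 : Point n d
  p3 : Point n d
  p4 : Point n d
  p5 : Point n d
  p6 : Point n d
  p7 : Point n d
  p8 : Point n d

/-- The four target bin-pairs `u1u2, u1u3, v1v2, v1v3` of a d-switching. -/
def targets (s : DSwitch n d) : List (Fin n × Fin n) :=
  [(s.p1.1, s.p5.1), (s.p1.1, s.p7.1), (s.p2.1, s.p6.1), (s.p2.1, s.p8.1)]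

/-- `s` is a valid d-switching on `P`. -/
def IsDSwitch (P : Pairing n d) (s : DSwitch n d) : Prop :=
  P.f s.p1 = s.p2 ∧ P.f s.p3 = s.p4 ∧ P.f s.p5 = s.p6 ∧ P.f s.p7 = s.p8 ∧
  s.p1.1 = s.p3.1 ∧ s.p2.1 = s.p4.1 ∧ s.p1 ≠ s.p3 ∧
  mult P s.p1.1 s.p2.1 = 2 ∧ mult P s.p5.1 s.p6.1 = 1 ∧ mult P s.p7.1 s.p8.1 = 1 ∧
  [s.p1.1, s.p2.1, s.p5.1, s.p6.1, s.p7.1, s.p8.1].Pairwise (· ≠ ·)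

/-- The number of target bin-pairs of `s` joined by at least one pair of `P`. -/
def joinedCount (P : Pairing n d) (s : DSwitch n d) : ℕ :=
  (targets s).countP fun t => decide (1 ≤ mult P t.1 t.2)

/-- A type I switching: a d-switching creating at most one new double edge. -/
def IsTypeI (P : Pairing n d) (s : DSwitch n d) : Prop :=
  IsDSwitch P s ∧ (∀ t ∈ targets s, mult P t.1 t.2 ≤ 1) ∧ joinedCount P s ≤ 1

/-- A type I switching of class A: it creates no new double edge. -/
def IsTypeIA (P : Pairing n d) (s : DSwitch n d) : Prop := IsTypeI P s ∧ joinedCount P s = 0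

/-- A type I switching of class B: it creates exactly one new double edge. -/
def IsTypeIB (P : Pairing n d) (s : DSwitch n d) : Prop := IsTypeI P s ∧ joinedCount P s = 1

/-- The labelled data (points 1–12) of a type II switching. -/
structure DSwitch2 (n d : ℕ) extends DSwitch n d where
  p9 : Point n d
  p10 : Point n d
  p11 : Point n d
  p12 : Point n d

/-- A type II switching: a d-switching creating exactly two new double edges, both
incident with `u1` or both incident with `v1`, together with the labelling
`{9,10}, {11,12}` (with 9 and 12 in `u1`, resp. `v1`) of the two existing pairs
joining the two joined target bin-pairs. -/
def IsTypeII (P : Pairing n d) (s : DSwitch2 n d) : Prop :=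
  IsDSwitch P s.toDSwitch ∧ (∀ t ∈ targets s.toDSwitch, mult P t.1 t.2 ≤ 1) ∧
  P.f s.p9 = s.p10 ∧ P.f s.p11 = s.p12 ∧
  ((s.p9.1 = s.p1.1 ∧ s.p12.1 = s.p1.1 ∧
      ((s.p10.1 = s.p5.1 ∧ s.p11.1 = s.p7.1) ∨ (s.p10.1 = s.p7.1 ∧ s.p11.1 = s.p5.1)) ∧
      mult P s.p1.1 s.p5.1 = 1 ∧ mult P s.p1.1 s.p7.1 = 1 ∧
      mult P s.p2.1 s.p6.1 = 0 ∧ mult P s.p2.1 s.p8.1 = 0) ∨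
    (s.p9.1 = s.p2.1 ∧ s.p12.1 = s.p2.1 ∧
      ((s.p10.1 = s.p6.1 ∧ s.p11.1 = s.p8.1) ∨ (s.p10.1 = s.p8.1 ∧ s.p11.1 = s.p6.1)) ∧
      mult P s.p2.1 s.p6.1 = 1 ∧ mult P s.p2.1 s.p8.1 = 1 ∧
      mult P s.p1.1 s.p5.1 = 0 ∧ mult P s.p1.1 s.p7.1 = 0))

/-- Conjugating a pairing by a permutation of the points: the pairs of
`conj P τ` are the images under `τ` of the pairs of `P`. -/
def conj (P : Pairing n d) (τ : Equiv.Perm (Point n d)) : Pairing n d where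
  f := fun x => τ (P.f (τ.symm x))
  invol := by intro x; simp [P.invol]
  nofix := by
    intro x h
    refine P.nofix (τ.symm x) ?_
    have h3 := congrArg τ.symm h
    simpa using h3

/-- The permutation performing a d-switching: it replaces the pairs
`{1,2},{3,4},{5,6},{7,8}` by `{1,5},{3,7},{2,6},{4,8}`. -/
def dtau (s : DSwitch n d) : Equiv.Perm (Point n d) :=
  (Equiv.swap s.p4 s.p7).trans (Equiv.swap s.p2 s.p5)

/-- The pairing resulting from performing a d-switching. -/
def dResult (P : Pairing n d) (s : DSwitch n d) : Pairing n d := conj P (dtau s)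

/-- `f_I(P)`: the number of type I switchings on `P`. -/
noncomputable def fI (P : Pairing n d) : ℕ := Nat.card {s : DSwitch n d // IsTypeI P s}

/-- `f_II(P)`: the number of type II switchings on `P`. -/
noncomputable def fII (P : Pairing n d) : ℕ := Nat.card {s : DSwitch2 n d // IsTypeII P s}

/-- `b_A(P)`: the number of class A switchings from pairings in `Φ1` producing `P`. -/
noncomputable def bA (m : ℕ) (P : Pairing n d) : ℕ :=
  Nat.card {q : Pairing n d × DSwitch n d //
    q.1 ∈ Phi1 n d m ∧ IsTypeIA q.1 q.2 ∧ dResult q.1 q.2 = P}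

/-- `b_B(P)`: the number of class B switchings (of type I or type II) from
pairings in `Φ1` producing `P`. -/
noncomputable def bB (m : ℕ) (P : Pairing n d) : ℕ :=
  Nat.card {q : Pairing n d × DSwitch n d //
    q.1 ∈ Phi1 n d m ∧ IsTypeIB q.1 q.2 ∧ dResult q.1 q.2 = P} +
  Nat.card {q : Pairing n d × DSwitch2 n d //
    q.1 ∈ Phi1 n d m ∧ IsTypeII q.1 q.2 ∧ dResult q.1 q.2.toDSwitch = P}

/-- `B_D = ⌊(1+γ)(d-1)²/4⌋`. -/
noncomputable def BD (d : ℕ) (γ : ℝ) : ℕ := i1Nat d γ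

/-- `B_L = max(⌈log dn⌉, 4d)`. -/
noncomputable def BL (n d : ℕ) : ℕ := max (⌈Real.log ((d : ℝ) * n)⌉.toNat) (4 * d)

/-- `B_T = max(⌈log dn⌉, ⌈d³/n⌉)`. -/
noncomputable def BT (n d : ℕ) : ℕ :=
  max (⌈Real.log ((d : ℝ) * n)⌉.toNat) (⌈(d : ℝ) ^ 3 / (n : ℝ)⌉.toNat)

/-- The set `A` of pairings that are not initially rejected:
`D(P) ≤ B_D`, `L(P) ≤ B_L` and `T(P) ≤ B_T`. -/
def AccSet (n d : ℕ) (γ : ℝ) : Set (Pairing n d) :=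
  {P | edgesWithMult P 2 ≤ BD d γ ∧ numLoops P ≤ BL n d ∧ edgesWithMult P 3 ≤ BT n d}

/-- The stratum `S^L_i` of the loop reduction phase. -/
def SL (n d : ℕ) (γ : ℝ) (i : ℕ) : Set (Pairing n d) :=
  {P | numLoops P = i ∧ (∀ u : Fin n, loopsAt P u ≤ 1) ∧
    edgesWithMult P 2 ≤ BD d γ ∧ edgesWithMult P 3 ≤ BT n d ∧
    ∀ u v : Fin n, u ≠ v → mult P u v ≤ 3}

/-- The labelled data (points 1–6) of a type L switching. -/
structure LSwitch (n d : ℕ) where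
  q1 : Point n d
  q2 : Point n d
  q3 : Point n d
  q4 : Point n d
  q5 : Point n d
  q6 : Point n d

/-- `s` is a valid type L switching on `P`. -/
def IsLSwitch (P : Pairing n d) (s : LSwitch n d) : Prop :=
  P.f s.q1 = s.q2 ∧ s.q1.1 = s.q2.1 ∧
  P.f s.q3 = s.q4 ∧ P.f s.q5 = s.q6 ∧
  mult P s.q3.1 s.q4.1 = 1 ∧ mult P s.q5.1 s.q6.1 = 1 ∧
  [s.q1.1, s.q3.1, s.q4.1, s.q5.1, s.q6.1].Pairwise (· ≠ ·) ∧
  mult P s.q1.1 s.q3.1 = 0 ∧ mult P s.q1.1 s.q5.1 = 0 ∧ mult P s.q4.1 s.q6.1 = 0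

/-- The permutation performing a type L switching: it replaces the pairs
`{1,2},{3,4},{5,6}` by `{1,3},{2,5},{4,6}`. -/
def ltau (s : LSwitch n d) : Equiv.Perm (Point n d) :=
  (Equiv.swap s.q4 s.q5).trans (Equiv.swap s.q2 s.q3)

/-- The pairing resulting from performing a type L switching. -/
def lResult (P : Pairing n d) (s : LSwitch n d) : Pairing n d := conj P (ltau s)

/-- `f_L(P)`: the number of type L switchings on `P`. -/
noncomputable def fL (P : Pairing n d) : ℕ := Nat.card {s : LSwitch n d // IsLSwitch P s}

/-- `b_A^L(P)`: the number of type L switchings from pairings in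
`⋃_{0 ≤ j ≤ B_L} S^L_j` producing `P`. -/
noncomputable def bAL (γ : ℝ) (P : Pairing n d) : ℕ :=
  Nat.card {q : Pairing n d × LSwitch n d //
    (∃ j ≤ BL n d, q.1 ∈ SL n d γ j) ∧ IsLSwitch q.1 q.2 ∧ lResult q.1 q.2 = P}

/-- The stratum `S^T_i` of the triple-edge reduction phase. -/
def ST (n d : ℕ) (γ : ℝ) (i : ℕ) : Set (Pairing n d) :=
  {P | numLoops P = 0 ∧ edgesWithMult P 3 = i ∧ edgesWithMult P 2 ≤ BD d γ ∧
    ∀ u v : Fin n, u ≠ v → mult P u v ≤ 3}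

/-- The labelled data (points 1–12) of a type T switching. -/
structure TSwitch (n d : ℕ) where
  r1 : Point n d
  r2 : Point n d
  r3 : Point n d
  r4 : Point n d
  r5 : Point n d
  r6 : Point n d
  r7 : Point n d
  r8 : Point n d
  r9 : Point n d
  r10 : Point n d
  r11 : Point n d
  r12 : Point n d

/-- `s` is a valid type T switching on `P`. -/
def IsTSwitch (P : Pairing n d) (s : TSwitch n d) : Prop :=
  P.f s.r1 = s.r2 ∧ P.f s.r3 = s.r4 ∧ P.f s.r5 = s.r6 ∧
  P.f s.r7 = s.r8 ∧ P.f s.r9 = s.r10 ∧ P.f s.r11 = s.r12 ∧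
  s.r1.1 = s.r3.1 ∧ s.r3.1 = s.r5.1 ∧ s.r2.1 = s.r4.1 ∧ s.r4.1 = s.r6.1 ∧
  s.r1 ≠ s.r3 ∧ s.r3 ≠ s.r5 ∧ s.r1 ≠ s.r5 ∧
  mult P s.r1.1 s.r2.1 = 3 ∧
  mult P s.r7.1 s.r8.1 = 1 ∧ mult P s.r9.1 s.r10.1 = 1 ∧ mult P s.r11.1 s.r12.1 = 1 ∧
  [s.r1.1, s.r2.1, s.r7.1, s.r8.1, s.r9.1, s.r10.1, s.r11.1, s.r12.1].Pairwise (· ≠ ·) ∧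
  mult P s.r1.1 s.r7.1 = 0 ∧ mult P s.r1.1 s.r9.1 = 0 ∧ mult P s.r1.1 s.r11.1 = 0 ∧
  mult P s.r2.1 s.r8.1 = 0 ∧ mult P s.r2.1 s.r10.1 = 0 ∧ mult P s.r2.1 s.r12.1 = 0

/-- The permutation performing a type T switching: it replaces the pairs
`{1,2},{3,4},{5,6},{7,8},{9,10},{11,12}` by `{1,7},{2,8},{3,9},{4,10},{5,11},{6,12}`. -/
def ttau (s : TSwitch n d) : Equiv.Perm (Point n d) :=
  ((Equiv.swap s.r2 s.r7).trans (Equiv.swap s.r4 s.r9)).trans (Equiv.swap s.r6 s.r11)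

/-- The pairing resulting from performing a type T switching. -/
def tResult (P : Pairing n d) (s : TSwitch n d) : Pairing n d := conj P (ttau s)

/-- `f_T(P)`: the number of type T switchings on `P`. -/
noncomputable def fT (P : Pairing n d) : ℕ := Nat.card {s : TSwitch n d // IsTSwitch P s}

/-- `b_A^T(P)`: the number of type T switchings from pairings in
`⋃_{0 ≤ j ≤ B_T} S^T_j` producing `P`. -/
noncomputable def bAT (γ : ℝ) (P : Pairing n d) : ℕ :=
  Nat.card {q : Pairing n d × TSwitch n d //
    (∃ j ≤ BT n d, q.1 ∈ ST n d γ j) ∧ IsTSwitch q.1 q.2 ∧ tResult q.1 q.2 = P}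

/-- The endpoints of the pair of `P` containing the point `a` lie in bins
`w1, w2` such that `u, v, w1, w2` are four distinct bins, `w1` is adjacent to `u`
and `w2` is adjacent to `v`. -/
def GoodPair (u v : Fin n) (P : Pairing n d) (a : Point n d) : Prop :=
  ∃ w1 w2 : Fin n,
    ((w1 = a.1 ∧ w2 = (P.f a).1) ∨ (w1 = (P.f a).1 ∧ w2 = a.1)) ∧
    [u, v, w1, w2].Pairwise (· ≠ ·) ∧ Adj P w1 u ∧ Adj P w2 v

/-- Four times the number of unordered pairs `{e, e'}` of distinct pairs of `P`
joining the same two distinct bins: ordered pairs of points `(a, b)` lying in a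
common bin whose mates also lie in a common (different) bin. -/
def parallelOrdered (P : Pairing n d) : ℕ :=
  (Finset.univ.filter fun q : Point n d × Point n d =>
    q.1.1 = q.2.1 ∧ (P.f q.1).1 = (P.f q.2).1 ∧ q.1.1 ≠ (P.f q.1).1 ∧ q.1 ≠ q.2).card

/-- Twice the number of unordered pairs of two distinct double edges of `P`
sharing a common bin (double edges being recorded as ordered bin-pairs `(u,v)`
with `u < v`). -/
def doubleSharedOrdered (P : Pairing n d) : ℕ :=
  (Finset.univ.filter fun q : (Fin n × Fin n) × (Fin n × Fin n) =>
    q.1.1 < q.1.2 ∧ q.2.1 < q.2.2 ∧ mult P q.1.1 q.1.2 = 2 ∧ mult P q.2.1 q.2.2 = 2 ∧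
    q.1 ≠ q.2 ∧
    (q.1.1 = q.2.1 ∨ q.1.1 = q.2.2 ∨ q.1.2 = q.2.1 ∨ q.1.2 = q.2.2)).card

/-- `m̄_I(i) = 4 i (M1 - 4i)²`. -/
noncomputable def mbarIp (nR dR : ℝ) (i : ℕ) : ℝ := 4 * i * (dR * nR - 4 * i) ^ 2

/-- `m̄_II(i) = 16 i (d-1)² (d-2) (d-3)`. -/
noncomputable def mbarIIp (dR : ℝ) (i : ℕ) : ℝ :=
  16 * i * (dR - 1) ^ 2 * (dR - 2) * (dR - 3)

/-- `m̲_A(i) = M2² - M2 (d-1) (16 i + 3d² + d + 6)`. -/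
noncomputable def mAp (nR dR : ℝ) (i : ℕ) : ℝ :=
  (nR * dR * (dR - 1)) ^ 2 - nR * dR * (dR - 1) * (dR - 1) * (16 * i + 3 * dR ^ 2 + dR + 6)

/-- `m̲_B(i) = 16 i (d-2) M2 - 16 i d (8 i d + 9 d² + 3 d³)`. -/
noncomputable def mBp (nR dR : ℝ) (i : ℕ) : ℝ :=
  16 * i * (dR - 2) * (nR * dR * (dR - 1)) - 16 * i * dR * (8 * i * dR + 9 * dR ^ 2 + 3 * dR ^ 3)

/-- The system of equations (18)–(21) of the paper determining the type
probabilities `ρ_I, ρ_II` and the (scaled) expected numbers of visits `x_j`,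
together with the positivity requirement on the `x_j`. -/
def Sys (nR dR ε : ℝ) (m : ℕ) (x ρI ρII : ℕ → ℝ) : Prop :=
  (∀ j ≤ m, 0 < x j) ∧
  (∀ i : ℕ, 1 ≤ i → i ≤ m → ρI i = 1 - ε) ∧
  ρI 0 = 0 ∧ ρII 0 = 0 ∧ ρII m = 0 ∧
  (∀ j : ℕ, 1 ≤ j → j + 1 ≤ m →
    x j = 1 + x (j + 1) * ρI (j + 1) * mAp nR dR j / mbarIp nR dR (j + 1)
        + x j * ρI j * mBp nR dR j / mbarIp nR dR j) ∧
  (x m = 1 + x m * ρI m * mBp nR dR m / mbarIp nR dR m) ∧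
  (x 0 = 1 + x 1 * ρI 1 * mAp nR dR 0 / mbarIp nR dR 1) ∧
  (∀ j : ℕ, j + 1 ≤ m →
    ρII j = ρI (j + 1) * (x (j + 1) / x j) * (mbarIIp dR j / mbarIp nR dR (j + 1)))

/-- The explicit unique positive root `x(d)`. -/
noncomputable def xd (dR : ℝ) : ℝ :=
  (7 / 2) * dR - 7 / 2 + 5 / dR +
    (1 / (2 * dR)) * Real.sqrt (65 * dR ^ 4 - 210 * dR ^ 3 + 461 * dR ^ 2 - 412 * dR + 196)

theorem exists_backward_recursion (m : ℕ) (a c : ℕ → ℝ) (ha : ∀ j < m, 0 ≤ a j)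
    (hc : ∀ j ≤ m, 0 < c j) :
    ∃ x : ℕ → ℝ, (∀ j ≤ m, 0 < x j) ∧ c m * x m = 1 ∧
      ∀ j < m, c j * x j = 1 + a j * x (j + 1) := by
  induction m generalizing a c with
  | zero =>
    have h0 := hc 0 le_rfl
    refine ⟨fun _ => (c 0)⁻¹, fun _ _ => inv_pos.2 h0, mul_inv_cancel₀ h0.ne', ?_⟩
    intro j hj
    omega
  | succ m ih =>
    obtain ⟨y, hy, hym, hyr⟩ := ih (fun j => a (j + 1)) (fun j => c (j + 1))
      (fun j hj => ha _ (by omega)) (fun j hj => hc _ (by omega))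
    have h0 := hc 0 (Nat.zero_le _)
    have ha0 := ha 0 m.succ_pos
    have hy0 := hy 0 (Nat.zero_le _)
    refine ⟨fun j => Nat.casesOn j ((1 + a 0 * y 0) / c 0) y, ?_, hym, ?_⟩
    · rintro (_ | j) hj
      · change 0 < (1 + a 0 * y 0) / c 0
        positivity
      · exact hy j (by omega)
    · rintro (_ | j) hj
      · exact mul_div_cancel₀ _ h0.ne'
      · exact hyr j (by omega)

theorem backward_recursion_unique {m : ℕ} {a c x y : ℕ → ℝ} (hc : ∀ j ≤ m, 0 < c j)
    (hxm : c m * x m = 1) (hx : ∀ j < m, c j * x j = 1 + a j * x (j + 1))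
    (hym : c m * y m = 1) (hy : ∀ j < m, c j * y j = 1 + a j * y (j + 1)) :
    ∀ j ≤ m, x j = y j := by
  intro j hj
  induction hj using Nat.decreasingInduction with
  | self => exact mul_left_cancel₀ (hc m le_rfl).ne' (hxm.trans hym.symm)
  | of_succ k hk ih =>
    refine mul_left_cancel₀ (hc k hk.le).ne' ?_
    rw [hx k hk, hy k hk, ih]

theorem four_mul_lt_sq_sub {d g K N t : ℝ} (hd : 2 ≤ d) (hg : (d - 1) ^ 2 ≤ g) (hK : 0 < K)
    (hN : N = K + 3 * d ^ 2 + d + 6 + 4 * g) (htg : t ≤ g) :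
    4 * ((d - 2) * (d - 1)) * N < (N - t) ^ 2 := by
  have hg0 : 0 < g := by nlinarith
  have hNpos : 0 < N := by nlinarith
  have h1 : (N - g) ^ 2 ≤ (N - t) ^ 2 := by
    apply pow_le_pow_left₀ <;> nlinarith
  have h2 : 4 * ((d - 2) * (d - 1)) < N - 2 * g := by nlinarith
  nlinarith [mul_lt_mul_of_pos_right h2 hNpos, sq_nonneg g]

theorem mul_classB_deficit_le {d g K N t : ℝ} (hd : 2 ≤ d) (hg : (d - 1) ^ 2 ≤ g) (hK : 0 < K)
    (hN : N = K + 3 * d ^ 2 + d + 6 + 4 * g) (htg : t ≤ g - 4) :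
    K * (d * (2 * t * d + 9 * d ^ 2 + 3 * d ^ 3) - (d - 2) * (d - 1) * N) ≤ 4 * (N - t) ^ 2 := by
  set P := 3 * d ^ 2 + d + 10 + 3 * g with hP
  have hg0 : 0 < g := by nlinarith
  have hPpos : 0 < P := by positivity
  have hNt : (K + P) ^ 2 ≤ (N - t) ^ 2 := by
    apply pow_le_pow_left₀ <;> nlinarith
  have hbr : 17 * d ^ 3 - 9 * d ^ 2 + 16 * d - 12 + g * (-2 * d ^ 2 + 12 * d - 8)
      ≤ P * (4 * d + 2) := by
    have h1 : 0 ≤ (g - (d - 1) ^ 2) * (2 * d ^ 2 + 14) :=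
      mul_nonneg (by linarith) (by positivity)
    have h2 : 0 ≤ (d - 2) ^ 3 := pow_nonneg (by linarith) 3
    nlinarith [sq_nonneg (d - 2), sq_nonneg (d * (d - 2)), mul_nonneg (sub_nonneg.2 hd) (sq_nonneg d)]
  have hsq : K * P * (4 * d - 6) ≤ (d ^ 2 - 3 * d + 6) * K ^ 2 + 4 * P ^ 2 := by
    nlinarith [sq_nonneg ((d - 3 / 2) * K - 2 * P), sq_nonneg K]
  have ht : K * (d * (2 * t * d + 9 * d ^ 2 + 3 * d ^ 3) - (d - 2) * (d - 1) * N) ≤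
      K * (d * (2 * g * d + 9 * d ^ 2 + 3 * d ^ 3) - (d - 2) * (d - 1) * N) := by
    have : t ≤ g := by linarith
    have hd0 : 0 < d := by linarith
    gcongr
  have hexp : K * (d * (2 * g * d + 9 * d ^ 2 + 3 * d ^ 3) - (d - 2) * (d - 1) * N) =
      K * (17 * d ^ 3 - 9 * d ^ 2 + 16 * d - 12 + g * (-2 * d ^ 2 + 12 * d - 8))
        - K ^ 2 * (d ^ 2 - 3 * d + 2) := by
    rw [hN]; ring
  nlinarith [mul_le_mul_of_nonneg_left hbr hK.le]

theorem mBp_div_mbarIp (nR dR : ℝ) (j : ℕ) (hj : j ≠ 0) :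
    mBp nR dR j / mbarIp nR dR j =
      4 * ((dR - 2) * (dR - 1) * (dR * nR)
        - dR * (2 * (4 * j) * dR + 9 * dR ^ 2 + 3 * dR ^ 3)) / (dR * nR - 4 * j) ^ 2 := by
  have hj' : (4 * j : ℝ) ≠ 0 := by positivity
  rw [← mul_div_mul_left _ ((dR * nR - 4 * j) ^ 2) hj']
  unfold mBp mbarIp
  congr 1
  ring

theorem mAp_eq (nR dR : ℝ) (j : ℕ) :
    mAp nR dR j =
      dR * nR * (dR - 1) ^ 2 * (dR * nR - 16 * j - 3 * dR ^ 2 - dR - 6) := by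
  unfold mAp; ring

theorem one_sub_classB_pos {nR dR g K ρ : ℝ} {j : ℕ} (hd : 2 ≤ dR) (hg : (dR - 1) ^ 2 ≤ g)
    (hK : 0 < K) (hN : dR * nR = K + 3 * dR ^ 2 + dR + 6 + 4 * g) (hρ : 0 < ρ) (hρ1 : ρ ≤ 1)
    (hj : 4 * (j : ℝ) ≤ g) :
    0 < 1 - ρ * (mBp nR dR j / mbarIp nR dR j) := by
  rcases eq_or_ne j 0 with rfl | hj0
  · simp [mBp]
  have hsq := four_mul_lt_sq_sub hd hg hK hN hj
  have hg0 : 0 ≤ g := (sq_nonneg _).trans hg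
  have hlt : mBp nR dR j / mbarIp nR dR j < 1 := by
    have hNj : 0 < dR * nR - 4 * j := by nlinarith
    have hdB : 0 ≤ dR * (2 * (4 * j) * dR + 9 * dR ^ 2 + 3 * dR ^ 3) := by
      have : 0 ≤ dR := by linarith
      positivity
    rw [mBp_div_mbarIp _ _ _ hj0, div_lt_one (by positivity)]
    linarith
  nlinarith

theorem mul_one_sub_classB_le {nR dR g K ρ : ℝ} {j : ℕ} (hd : 2 ≤ dR) (hg : (dR - 1) ^ 2 ≤ g)
    (hK : 0 < K) (hN : dR * nR = K + 3 * dR ^ 2 + dR + 6 + 4 * g) (hρ : 0 < ρ) (hρ1 : ρ ≤ 1)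
    (hj : 4 * (j : ℝ) ≤ g - 4) :
    K * (1 - ρ * (mBp nR dR j / mbarIp nR dR j)) ≤
      dR * nR - 16 * j - 3 * dR ^ 2 - dR - 6 := by
  rcases eq_or_ne j 0 with rfl | hj0
  · have h0 : mBp nR dR 0 = 0 := by simp [mBp]
    rw [h0, zero_div, mul_zero, sub_zero, mul_one, Nat.cast_zero]
    linarith [sq_nonneg (dR - 1)]
  have hbound : -(K * (mBp nR dR j / mbarIp nR dR j)) ≤ 16 := by
    have hg0 : 0 ≤ g := (sq_nonneg _).trans hg
    have hNj : 0 < dR * nR - 4 * j := by nlinarith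
    have hB := mul_classB_deficit_le hd hg hK hN hj
    rw [mBp_div_mbarIp _ _ _ hj0, mul_div_assoc', ← neg_div, div_le_iff₀ (by positivity)]
    linarith
  nlinarith

theorem mAp_pos {nR dR g K : ℝ} {j : ℕ} (hd : 2 ≤ dR) (hg : (dR - 1) ^ 2 ≤ g)
    (hK : 0 < K) (hN : dR * nR = K + 3 * dR ^ 2 + dR + 6 + 4 * g) (hj : 4 * (j : ℝ) ≤ g) :
    0 < mAp nR dR j := by
  have hg0 : 0 ≤ g := (sq_nonneg _).trans hg
  rw [mAp_eq]
  have hN0 : 0 < dR * nR := by nlinarith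
  have hd1 : 0 < dR - 1 := by linarith
  have hA : 0 < dR * nR - 16 * j - 3 * dR ^ 2 - dR - 6 := by linarith
  positivity

/-- If `q` is the type I inflow per visit, normalised by `m̲_A`, then the induced type II
probability is at most the threshold imposed on `ε`. -/
theorem mul_mbarIIp_le {nR dR g K ρ q : ℝ} {j : ℕ} (hd : 2 ≤ dR)
    (hd23 : 0 ≤ (dR - 2) * (dR - 3)) (hg : (dR - 1) ^ 2 ≤ g)
    (hK : 0 < K) (hN : dR * nR = K + 3 * dR ^ 2 + dR + 6 + 4 * g) (hρ : 0 < ρ) (hρ1 : ρ ≤ 1)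
    (hj : 4 * (j : ℝ) ≤ g - 4)
    (hq : q * mAp nR dR j ≤ 1 - ρ * (mBp nR dR j / mbarIp nR dR j)) :
    q * mbarIIp dR j ≤ 4 * g * ((dR - 2) * (dR - 3)) / (dR * nR * K) := by
  have hg0 : 0 ≤ g := (sq_nonneg _).trans hg
  have hN0 : 0 < dR * nR := by nlinarith
  have hA : 0 < dR * nR - 16 * j - 3 * dR ^ 2 - dR - 6 := by linarith
  have hB := mul_one_sub_classB_le hd hg hK hN hρ hρ1 hj
  rw [mAp_eq] at hq
  have hone : q * (dR - 1) ^ 2 * (dR * nR * K) ≤ 1 := by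
    refine le_of_mul_le_mul_right ?_ hA
    linarith [mul_le_mul_of_nonneg_left hq hK.le]
  rw [le_div_iff₀ (by positivity)]
  have hjg : 16 * (j : ℝ) ≤ 4 * g := by linarith
  calc q * mbarIIp dR j * (dR * nR * K)
      = 16 * j * ((dR - 2) * (dR - 3)) * (q * (dR - 1) ^ 2 * (dR * nR * K)) := by
        unfold mbarIIp; ring
    _ ≤ 16 * j * ((dR - 2) * (dR - 3)) * 1 := by gcongr
    _ ≤ 4 * g * ((dR - 2) * (dR - 3)) := by
        rw [mul_one]
        gcongr

/-- The part of `Sys` that determines `x` is a backward recursion. -/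
theorem Sys.recursion {nR dR ε : ℝ} {m : ℕ} {x ρI ρII : ℕ → ℝ} (hm1 : 1 ≤ m)
    (h : Sys nR dR ε m x ρI ρII) :
    (1 - (1 - ε) * (mBp nR dR m / mbarIp nR dR m)) * x m = 1 ∧
      ∀ j < m, (1 - (1 - ε) * (mBp nR dR j / mbarIp nR dR j)) * x j =
        1 + (1 - ε) * mAp nR dR j / mbarIp nR dR (j + 1) * x (j + 1) := by
  obtain ⟨-, hρ, -, -, -, hmid, hlast, hfirst, -⟩ := h
  constructor
  · rw [hρ m hm1 le_rfl] at hlast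
    linear_combination hlast
  · rintro (_ | j) hj
    · rw [hρ 1 le_rfl hm1] at hfirst
      simp only [mBp, Nat.cast_zero]
      linear_combination hfirst
    · have := hmid (j + 1) (by omega) (by omega)
      rw [hρ (j + 1) (by omega) (by omega), hρ (j + 1 + 1) (by omega) (by omega)] at this
      linear_combination this

/-- Lemma 3: existence and uniqueness of the solution of the system
(18)–(21), with `ρ_I(i) = 1 - ε` for `1 ≤ i ≤ i1`, and the fact that the unique
solution satisfies `ρ_I(i), ρ_II(i) ≥ 0` and `ρ_I(i) + ρ_II(i) ≤ 1`. -/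
theorem stmt_4 (n d : ℤ) (hd : 2 ≤ d) (he : Even (d * n)) (γ : ℝ) (hγ : 0 < γ)
    (m : ℕ) (hm : (m : ℤ) = ⌊(1 + γ) * ((d : ℝ) - 1) ^ 2 / 4⌋) (hm1 : 1 ≤ m)
    (ε : ℝ)
    (hpos : (0 : ℝ) <
      (d : ℝ) * n - 7 * (d : ℝ) ^ 2 + 7 * (d : ℝ) - 10 - 4 * γ * ((d : ℝ) - 1) ^ 2)
    (hε1 : 4 * (1 + γ) * ((d : ℝ) - 1) ^ 2 * ((d : ℝ) - 2) * ((d : ℝ) - 3) /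
        ((d : ℝ) * (n : ℝ) *
          ((d : ℝ) * n - 7 * (d : ℝ) ^ 2 + 7 * (d : ℝ) - 10 - 4 * γ * ((d : ℝ) - 1) ^ 2))
      ≤ ε)
    (hε2 : ε < 1) :
    ∃ x ρI ρII : ℕ → ℝ, Sys (n : ℝ) (d : ℝ) ε m x ρI ρII ∧
      (∀ x' ρI' ρII' : ℕ → ℝ, Sys (n : ℝ) (d : ℝ) ε m x' ρI' ρII' →
        ∀ j ≤ m, x' j = x j ∧ ρI' j = ρI j ∧ ρII' j = ρII j) ∧
      (∀ i ≤ m, 0 ≤ ρI i ∧ 0 ≤ ρII i ∧ ρI i + ρII i ≤ 1) := by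
  have hdR : (2 : ℝ) ≤ d := by exact_mod_cast hd
  have hd23 : (0 : ℝ) ≤ ((d : ℝ) - 2) * ((d : ℝ) - 3) := by
    have h : (0 : ℤ) ≤ (d - 2) * (d - 3) := by
      rcases hd.eq_or_lt with rfl | h
      · norm_num
      · exact mul_nonneg (by omega) (by omega)
    exact_mod_cast h
  set g : ℝ := (1 + γ) * ((d : ℝ) - 1) ^ 2 with hgdef
  set K : ℝ := (d : ℝ) * n - 7 * (d : ℝ) ^ 2 + 7 * (d : ℝ) - 10 - 4 * γ * ((d : ℝ) - 1) ^ 2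
    with hKdef
  have hg : ((d : ℝ) - 1) ^ 2 ≤ g := by
    have := mul_nonneg hγ.le (sq_nonneg ((d : ℝ) - 1))
    linarith
  have hN : (d : ℝ) * n = K + 3 * (d : ℝ) ^ 2 + d + 6 + 4 * g := by
    rw [hKdef, hgdef]; ring
  have hg0 : 0 ≤ g := (sq_nonneg _).trans hg
  have hN0 : 0 < (d : ℝ) * n := by nlinarith
  have hεE : 4 * g * (((d : ℝ) - 2) * ((d : ℝ) - 3)) / ((d : ℝ) * n * K) ≤ ε := by
    convert hε1 using 2
    rw [hgdef]; ring
  have hε0 : 0 ≤ ε := le_trans (by positivity) hεE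
  have hρ : 0 < 1 - ε := by linarith
  have hρ1 : 1 - ε ≤ 1 := by linarith
  have hmg : 4 * (m : ℝ) ≤ g := by
    have h : ((m : ℤ) : ℝ) ≤ g / 4 := hm ▸ Int.floor_le _
    push_cast at h
    linarith
  have hjg : ∀ j ≤ m, 4 * (j : ℝ) ≤ g := fun j hj => by
    have : (j : ℝ) ≤ m := by exact_mod_cast hj
    linarith
  have hjg' : ∀ j < m, 4 * (j : ℝ) ≤ g - 4 := fun j hj => by
    have : (j : ℝ) + 1 ≤ m := by exact_mod_cast hj
    linarith
  have hI : ∀ j < m, 0 < mbarIp n d (j + 1) := fun j hj => by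
    have h := hjg (j + 1) hj
    have hne : 0 < (d : ℝ) * n - 4 * ((j + 1 : ℕ) : ℝ) := by nlinarith
    unfold mbarIp
    positivity
  have hc : ∀ j ≤ m, 0 < 1 - (1 - ε) * (mBp n d j / mbarIp n d j) := fun j hj =>
    one_sub_classB_pos hdR hg hpos hN hρ hρ1 (hjg j hj)
  have ha : ∀ j < m, 0 ≤ (1 - ε) * mAp n d j / mbarIp n d (j + 1) := fun j hj =>
    div_nonneg (mul_nonneg hρ.le (mAp_pos hdR hg hpos hN (hjg j hj.le)).le) (hI j hj).le
  obtain ⟨x, hx, hxm, hxr⟩ := exists_backward_recursion m _ _ ha hc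
  have hm0 : m ≠ 0 := by omega
  refine ⟨x, fun j => if j = 0 then 0 else 1 - ε,
    fun j => if j < m then
      (1 - ε) * (x (j + 1) / x j) * (mbarIIp d j / mbarIp n d (j + 1)) else 0, ?_, ?_, ?_⟩
  · refine ⟨hx, fun i hi _ => if_neg (by omega), if_pos rfl, ?_, if_neg (lt_irrefl m), ?_, ?_, ?_,
      ?_⟩
    · simp [mbarIIp]
    · intro j hj hjm
      beta_reduce
      rw [if_neg (by omega), if_neg (by omega)]
      linear_combination hxr j (by omega)
    · beta_reduce
      rw [if_neg hm0]
      linear_combination hxm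
    · have h := hxr 0 (by omega)
      beta_reduce
      rw [if_neg one_ne_zero]
      simp only [mBp, Nat.cast_zero, zero_add] at h
      linear_combination h
    · intro j hj
      beta_reduce
      rw [if_pos (show j < m from hj), if_neg j.succ_ne_zero]
  · intro x' ρI' ρII' h
    obtain ⟨hm', hr'⟩ := h.recursion hm1
    have hxx := backward_recursion_unique hc hm' hr' hxm hxr
    obtain ⟨-, hρ', hρ0, -, hρm, -, -, -, hII⟩ := h
    refine fun j hj => ⟨hxx j hj, ?_, ?_⟩
    · beta_reduce
      split_ifs with h0
      · rw [h0, hρ0]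
      · exact hρ' j (by omega) hj
    · beta_reduce
      split_ifs with hjm
      · rw [hII j hjm, hρ' (j + 1) (by omega) hjm, hxx j hj, hxx (j + 1) hjm]
      · rw [le_antisymm hj (not_lt.1 hjm), hρm]
  · intro i hi
    have hbound : ∀ j < m,
        0 ≤ (1 - ε) * (x (j + 1) / x j) * (mbarIIp d j / mbarIp n d (j + 1)) ∧
        (1 - ε) * (x (j + 1) / x j) * (mbarIIp d j / mbarIp n d (j + 1)) ≤ ε := fun j hj => by
      have hx0 := hx j hj.le
      have hx1 := hx (j + 1) hj
      have hI' := hI j hj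
      have hII0 : 0 ≤ mbarIIp d j := by
        rw [mbarIIp, mul_assoc _ ((d : ℝ) - 2)]
        positivity
      have hq : (1 - ε) * (x (j + 1) / x j) / mbarIp n d (j + 1) * mAp n d j ≤
          1 - (1 - ε) * (mBp n d j / mbarIp n d j) := by
        refine le_of_mul_le_mul_right ?_ hx0
        rw [hxr j hj]
        have : (1 - ε) * (x (j + 1) / x j) / mbarIp n d (j + 1) * mAp n d j * x j =
            (1 - ε) * mAp n d j / mbarIp n d (j + 1) * x (j + 1) := by
          field_simp
        linarith
      refine ⟨by positivity, le_trans (le_of_eq ?_) ((mul_mbarIIp_le hdR hd23 hg hpos hN hρ hρ1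
        (hjg' j hj) hq).trans hεE)⟩
      ring
    refine ⟨?_, ?_, ?_⟩ <;> beta_reduce
    · split_ifs <;> linarith
    · split_ifs with him
      exacts [(hbound i him).1, le_rfl]
    · by_cases him : i < m
      · have h := (hbound i him).2
        rw [if_pos him]
        split_ifs <;> linarith
      · rw [if_neg him, if_neg (by omega)]
        linarith

end Reg
end

section
/- Fix a constant γ > 0 and a function d : ℕ → ℕ with d(n) ≥ 2 for all n and d(n)/√n → 0 as n → ∞. Then there exist a constant C > 0 and n0 such that the following holds for all n ≥ n0 with d(n)·n even, writing d = d(n) and i1 = ⌊(1+γ)(d−1)²/4⌋. Let 0 ≤ i ≤ i1, let u, v be two distinct bins, and let E be any one of the three events: {uv is a single edge}, {uv is a double edge}, {u and v are not adjacent}. If the set {P ∈ S_i : P satisfies E} is nonempty, then for P chosen uniformly at random from this set and x a uniformly random pair of P, the probability that the two endpoints of x lie in bins w1, w2 such that u, v, w1, w2 are four distinct bins, w1 is adjacent to u, and w2 is adjacent to v, is at most C·d²/n². -/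
/-!
Formalization of the pairing model of random `d`-regular (multi)graphs and of the
switchings used in the uniform sampler *REG* of Gao and Wormald,
"Uniform generation of random regular graphs".

Bins are elements of `Fin n`; each bin contains `d` points, so points are
elements of `Fin n × Fin d`.  A pairing is a perfect matching of the points,
modelled as a fixed-point-free involution on the points: the pairs of the
pairing are the orbits `{x, P.f x}`.
-/

namespace Reg

variable {n d : ℕ}

open Classical in
noncomputable instance : Fintype (Pairing n d) := Fintype.ofFinite _

/-- The switching replacing the pairs `{a, P.f a}`, `{c, P.f c}` by `{a, c}`, `{P.f a, P.f c}`. -/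
def sw (P : Pairing n d) (a c : Point n d) : Pairing n d := conj P (Equiv.swap (P.f a) c)

/-- Indicator that the unordered bin-pairs `{p, q}` and `{s, t}` agree (for `p ≠ q`). -/
def pairInd (p q s t : Fin n) : ℕ :=
  (if p = s ∧ q = t then 1 else 0) + (if q = s ∧ p = t then 1 else 0)

theorem f_injective (P : Pairing n d) : Function.Injective P.f :=
  fun x y h => by rw [← P.invol x, h, P.invol]

theorem Pairing.ext_f {P Q : Pairing n d} (h : P.f = Q.f) : P = Q := by
  cases P; cases Q; congr

theorem conj_injective (τ : Equiv.Perm (Point n d)) :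
    Function.Injective (fun P : Pairing n d => conj P τ) := by
  intro P Q h
  apply Pairing.ext_f
  funext x
  have h1 := congrFun (congrArg Pairing.f h) (τ x)
  simpa [conj] using h1

theorem sw_f_left (P : Pairing n d) {a c : Point n d} (h : c ≠ a) : (sw P a c).f a = c := by
  simp [sw, conj, Equiv.swap_apply_of_ne_of_ne (P.nofix a).symm h.symm]

theorem sw_f_right (P : Pairing n d) {a c : Point n d} (h : c ≠ a) : (sw P a c).f c = a := by
  have h1 := congrArg (sw P a c).f (sw_f_left P h)
  rw [(sw P a c).invol] at h1
  exact h1.symm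

theorem sw_f_mate_left (P : Pairing n d) {a c : Point n d} (h : c ≠ a) :
    (sw P a c).f (P.f a) = P.f c := by
  have h3 : P.f c ≠ P.f a := fun h' => h (f_injective P h')
  simp [sw, conj, Equiv.swap_apply_of_ne_of_ne h3 (P.nofix c)]

theorem sw_f_of_ne (P : Pairing n d) {a c x : Point n d} (h1 : x ≠ a) (h2 : x ≠ P.f a)
    (h3 : x ≠ c) (h4 : x ≠ P.f c) : (sw P a c).f x = P.f x := by
  have h5 : P.f x ≠ P.f a := fun h => h1 (f_injective P h)
  have h6 : P.f x ≠ c := fun h => h4 (by rw [← h, P.invol])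
  simp [sw, conj, Equiv.swap_apply_of_ne_of_ne h2 h3, Equiv.swap_apply_of_ne_of_ne h5 h6]

theorem mult_eq_sum (P : Pairing n d) (s t : Fin n) :
    mult P s t = ∑ x : Point n d, if x.1 = s ∧ (P.f x).1 = t then 1 else 0 := by
  simp [mult, Finset.sum_boole]

theorem mult_comm (P : Pairing n d) (s t : Fin n) : mult P s t = mult P t s := by
  unfold mult
  refine Finset.card_bij (fun x _ => P.f x) ?_ ?_ ?_
  · simp +contextual [P.invol]
  · exact fun x _ y _ h => f_injective P h
  · intro x hx
    refine ⟨P.f x, ?_, P.invol x⟩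
    simp at hx
    simp [P.invol, hx]

theorem mult_sw (P : Pairing n d) {a c : Point n d} (h1 : c ≠ a) (h2 : c ≠ P.f a) (s t : Fin n) :
    mult (sw P a c) s t + pairInd a.1 (P.f a).1 s t + pairInd c.1 (P.f c).1 s t =
      mult P s t + pairInd a.1 c.1 s t + pairInd (P.f a).1 (P.f c).1 s t := by
  have e1 : a ≠ P.f a := (P.nofix a).symm
  have e2 : c ≠ P.f c := (P.nofix c).symm
  have e3 : P.f a ≠ P.f c := fun h => h1 (f_injective P h).symm
  have e4 : a ≠ P.f c := fun h => h2 (by rw [h, P.invol])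
  have key : ∀ g : Point n d → ℕ, ∑ x, g x =
      (g a + g (P.f a) + g c + g (P.f c)) +
        ∑ x ∈ ({a, P.f a, c, P.f c} : Finset (Point n d))ᶜ, g x := by
    intro g
    rw [← Finset.sum_add_sum_compl ({a, P.f a, c, P.f c} : Finset (Point n d)) g]
    rw [Finset.sum_insert (by simp [e1, e4, h1.symm]), Finset.sum_insert (by simp [h2.symm, e3]),
      Finset.sum_insert (by simp [e2]), Finset.sum_singleton]
    ring
  have hrest : ∑ x ∈ ({a, P.f a, c, P.f c} : Finset (Point n d))ᶜ,
        (if x.1 = s ∧ ((sw P a c).f x).1 = t then 1 else 0) =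
      ∑ x ∈ ({a, P.f a, c, P.f c} : Finset (Point n d))ᶜ,
        (if x.1 = s ∧ (P.f x).1 = t then 1 else 0) := by
    refine Finset.sum_congr rfl fun x hx => ?_
    simp at hx
    rw [sw_f_of_ne P hx.1 hx.2.1 hx.2.2.1 hx.2.2.2]
  have hm : (sw P a c).f (P.f c) = P.f a := by
    rw [← sw_f_mate_left P h1, (sw P a c).invol]
  rw [mult_eq_sum, mult_eq_sum, key, key, hrest, sw_f_left P h1, sw_f_right P h1,
    sw_f_mate_left P h1, hm, P.invol, P.invol]
  unfold pairInd
  ring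

theorem mult_eq_zero_iff (P : Pairing n d) (s t : Fin n) :
    mult P s t = 0 ↔ ∀ x : Point n d, x.1 = s → (P.f x).1 ≠ t := by
  simp [mult, Finset.filter_eq_empty_iff]

theorem one_le_mult (P : Pairing n d) (x : Point n d) : 1 ≤ mult P x.1 (P.f x).1 :=
  Finset.card_pos.mpr ⟨x, by simp⟩

theorem eq_of_mult_le_two (P : Pairing n d) {s t : Fin n} (h : mult P s t ≤ 2) {a b b' : Point n d}
    (ha : a.1 = s ∧ (P.f a).1 = t) (hb : b.1 = s ∧ (P.f b).1 = t)
    (hb' : b'.1 = s ∧ (P.f b').1 = t) (hab : a ≠ b) (hab' : a ≠ b') : b = b' := by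
  by_contra hne
  have : 2 < mult P s t := Finset.two_lt_card.mpr
    ⟨a, by simpa using ha, b, by simpa using hb, b', by simpa using hb', hab, hab', hne⟩
  omega

theorem numLoops_eq_zero_iff (P : Pairing n d) : numLoops P = 0 ↔ ∀ s, mult P s s = 0 := by
  unfold numLoops
  rw [Nat.div_eq_zero_iff]
  constructor
  · intro h s
    rw [mult_eq_zero_iff]
    intro x hx hx'
    have : 1 < (Finset.univ.filter fun a : Point n d => (P.f a).1 = a.1).card :=
      Finset.one_lt_card.mpr ⟨x, by simp [hx, hx'], P.f x, by simp [P.invol, hx, hx'],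
        (P.nofix x).symm⟩
    omega
  · intro h
    right
    rw [Finset.filter_eq_empty_iff.mpr, Finset.card_empty]
    · norm_num
    · intro x _ hx
      exact (mult_eq_zero_iff P _ _).mp (h x.1) x rfl hx

theorem sum_pairInd {p q : Fin n} (h : p ≠ q) :
    ∑ e ∈ Finset.univ.filter (fun e : Fin n × Fin n => e.1 < e.2), pairInd p q e.1 e.2 = 1 := by
  unfold pairInd
  rw [Finset.sum_add_distrib]
  have h1 : ∀ p q : Fin n, (∑ e ∈ Finset.univ.filter (fun e : Fin n × Fin n => e.1 < e.2),
      if p = e.1 ∧ q = e.2 then 1 else 0) = if p < q then 1 else 0 := by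
    intro p q
    have : ∀ e : Fin n × Fin n, (p = e.1 ∧ q = e.2) ↔ (p, q) = e := by
      rintro ⟨x, y⟩; simp
    simp only [this, Finset.sum_ite_eq]
    simp
  rw [h1, h1]
  rcases lt_or_gt_of_ne h with h | h
  · simp [h, h.le]
  · simp [h, h.le]

theorem edgesWithMult_eq_sum (P : Pairing n d) (k : ℕ) :
    edgesWithMult P k = ∑ e ∈ Finset.univ.filter (fun e : Fin n × Fin n => e.1 < e.2),
      if mult P e.1 e.2 = k then 1 else 0 := by
  simp [edgesWithMult, Finset.sum_boole, Finset.filter_filter]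

theorem card_adj_le (P : Pairing n d) (w : Fin n) :
    (Finset.univ.filter fun y => 1 ≤ mult P w y).card ≤ d := by
  have : (Finset.univ.filter fun y => 1 ≤ mult P w y) ⊆
      Finset.univ.image (fun j : Fin d => (P.f (w, j)).1) := by
    intro y hy
    simp only [Finset.mem_filter, Finset.mem_univ, true_and] at hy
    obtain ⟨x, hx⟩ := Finset.card_pos.mp hy
    simp only [Finset.mem_filter, Finset.mem_univ, true_and] at hx
    obtain ⟨⟨x1, x2⟩, rfl, rfl⟩ := (⟨x, hx.1, hx.2⟩ : ∃ x : Point n d, x.1 = w ∧ (P.f x).1 = y)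
    simp
  exact (Finset.card_le_card this).trans (Finset.card_image_le.trans (by simp))

theorem single_switch_mult {m m' : Fin n → Fin n → ℕ} {w₁ w₂ x y : Fin n}
    (hc : ∀ s t, m s t = m t s) (hw : w₁ ≠ w₂) (hxy : x ≠ y) (hx1 : x ≠ w₁) (hx2 : x ≠ w₂)
    (hy1 : y ≠ w₁) (hy2 : y ≠ w₂) (h1 : m w₁ w₂ = 1) (h2 : m x y = 1) (h3 : m w₁ x = 0)
    (h4 : m w₂ y = 0) {s t : Fin n}
    (h : m' s t + pairInd w₁ w₂ s t + pairInd x y s t =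
      m s t + pairInd w₁ x s t + pairInd w₂ y s t) :
    m' s t = m s t ∨ (s ≠ t ∧ m' s t ≤ 1 ∧ m s t ≤ 1) := by
  have h1' := (hc w₂ w₁).trans h1
  have h2' := (hc y x).trans h2
  have h3' := (hc x w₁).trans h3
  have h4' := (hc y w₂).trans h4
  unfold pairInd at h
  have cs : s = w₁ ∨ s = w₂ ∨ s = x ∨ s = y ∨
      (w₁ ≠ s ∧ w₂ ≠ s ∧ x ≠ s ∧ y ≠ s) := by grind
  have ct : t = w₁ ∨ t = w₂ ∨ t = x ∨ t = y ∨
      (w₁ ≠ t ∧ w₂ ≠ t ∧ x ≠ t ∧ y ≠ t) := by grind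
  rcases cs with rfl | rfl | rfl | rfl | cs <;> rcases ct with rfl | rfl | rfl | rfl | ct <;>
    simp [*, hw.symm, hxy.symm, hx1.symm, hx2.symm, hy1.symm, hy2.symm] at h ⊢ <;> grind

theorem double_switch_mult {m m' : Fin n → Fin n → ℕ} {w₁ w₂ x y z : Fin n}
    (hc : ∀ s t, m s t = m t s) (hw : w₁ ≠ w₂) (hxy : x ≠ y) (hx1 : x ≠ w₁) (hx2 : x ≠ w₂)
    (hy1 : y ≠ w₁) (hy2 : y ≠ w₂) (hxz : x ≠ z) (hz1 : z ≠ w₁) (hz2 : z ≠ w₂) (hyz : y ≠ z)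
    (h1 : m w₁ w₂ = 2) (h2 : m x y = 1) (h3 : m x z = 1) (h4 : m w₁ x = 0)
    (h5 : m w₂ y = 0) (h6 : m w₂ z = 0) {s t : Fin n}
    (h : m' s t + 2 * pairInd w₁ w₂ s t + pairInd x y s t + pairInd x z s t =
      m s t + 2 * pairInd w₁ x s t + pairInd w₂ y s t + pairInd w₂ z s t) :
    (if m' s t = 2 then 1 else 0) + pairInd w₁ w₂ s t =
        (if m s t = 2 then 1 else 0) + pairInd w₁ x s t ∧
      (m' s t = m s t ∨ (s ≠ t ∧ m' s t ≤ 2)) := by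
  have h1' := (hc w₂ w₁).trans h1
  have h2' := (hc y x).trans h2
  have h3' := (hc z x).trans h3
  have h4' := (hc x w₁).trans h4
  have h5' := (hc y w₂).trans h5
  have h6' := (hc z w₂).trans h6
  unfold pairInd at h ⊢
  have cs : s = w₁ ∨ s = w₂ ∨ s = x ∨ s = y ∨ s = z ∨
      (w₁ ≠ s ∧ w₂ ≠ s ∧ x ≠ s ∧ y ≠ s ∧ z ≠ s) := by grind
  have ct : t = w₁ ∨ t = w₂ ∨ t = x ∨ t = y ∨ t = z ∨
      (w₁ ≠ t ∧ w₂ ≠ t ∧ x ≠ t ∧ y ≠ t ∧ z ≠ t) := by grind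
  rcases cs with rfl | rfl | rfl | rfl | rfl | cs <;> rcases ct with rfl | rfl | rfl | rfl | rfl | ct <;>
    simp [*, hw.symm, hxy.symm, hx1.symm, hx2.symm, hy1.symm, hy2.symm,
      hxz.symm, hz1.symm, hz2.symm, hyz.symm] at h ⊢ <;> grind

theorem pairInd_eq_zero {p q s t : Fin n} (hp : p ≠ s) (hq : q ≠ s) : pairInd p q s t = 0 := by
  simp [pairInd, hp, hq]

theorem mem_SD_iff (P : Pairing n d) (i : ℕ) :
    P ∈ SD n d i ↔
      (∀ s, mult P s s = 0) ∧ (∀ s t, mult P s t ≤ 2) ∧ edgesWithMult P 2 = i := by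
  unfold SD
  rw [Set.mem_ofPred_eq, numLoops_eq_zero_iff]
  constructor
  · rintro ⟨h1, h2, h3⟩
    refine ⟨h1, fun s t => ?_, h3⟩
    by_cases hst : s = t
    · subst hst
      simp [h1]
    · exact h2 s t hst
  · rintro ⟨h1, h2, h3⟩
    exact ⟨h1, fun s t _ => h2 s t, h3⟩

/-- The bins at which a pair between `w₁` and `w₂` can be switched. -/
structure NiceBin (P : Pairing n d) (u v w₁ w₂ x : Fin n) : Prop where
  ne_u : x ≠ u
  ne_v : x ≠ v
  ne_left : x ≠ w₁
  ne_right : x ≠ w₂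
  mult_u : mult P x u = 0
  mult_v : mult P x v = 0
  mult_left : mult P x w₁ = 0
  mult_right : mult P x w₂ = 0
  mult_le_one : ∀ y, mult P x y ≤ 1
  nbr_mult_right : ∀ y, 1 ≤ mult P x y → mult P w₂ y = 0

/-- `{a, P.f a}` joins a neighbour of `u` to a neighbour of `v`, in this order. -/
structure OrientedGood (u v : Fin n) (P : Pairing n d) (a : Point n d) : Prop where
  ne₁ : a.1 ≠ u
  ne₂ : a.1 ≠ v
  ne₃ : (P.f a).1 ≠ u
  ne₄ : (P.f a).1 ≠ v
  ne₅ : a.1 ≠ (P.f a).1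
  adj_u : 1 ≤ mult P u a.1
  adj_v : 1 ≤ mult P v (P.f a).1

theorem goodPair_imp {u v : Fin n} {P : Pairing n d} {a : Point n d} (h : GoodPair u v P a) :
    OrientedGood u v P a ∨ OrientedGood u v P (P.f a) := by
  obtain ⟨w₁, w₂, h1, h2, h3, h4⟩ := h
  simp only [List.pairwise_cons, List.mem_cons, List.not_mem_nil, or_false] at h2
  obtain ⟨hu, hv, hw, -⟩ := h2
  have h3' := h3.2
  have h4' := h4.2
  rw [mult_comm] at h3' h4'
  rcases h1 with ⟨rfl, rfl⟩ | ⟨rfl, rfl⟩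
  · left
    exact ⟨(hu _ (by simp)).symm, (hv _ (by simp)).symm, (hu _ (by simp)).symm,
      (hv _ (by simp)).symm, hw _ rfl, h3', h4'⟩
  · right
    refine ⟨(hu _ (by simp)).symm, (hv _ (by simp)).symm, ?_, ?_, ?_, h3', ?_⟩ <;>
      rw [P.invol]
    exacts [(hu _ (by simp)).symm, (hv _ (by simp)).symm, hw _ rfl, h4']

theorem mate_props {P : Pairing n d} {i : ℕ} (hP : P ∈ SD n d i) {u v w₁ w₂ : Fin n}
    {c : Point n d} (h : NiceBin P u v w₁ w₂ c.1) :
    mult P c.1 (P.f c).1 = 1 ∧ c.1 ≠ (P.f c).1 ∧ (P.f c).1 ≠ u ∧ (P.f c).1 ≠ v ∧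
      (P.f c).1 ≠ w₁ ∧ (P.f c).1 ≠ w₂ ∧ mult P w₂ (P.f c).1 = 0 := by
  have h1 := one_le_mult P c
  refine ⟨le_antisymm (h.mult_le_one _) h1, ?_, ?_, ?_, ?_, ?_, h.nbr_mult_right _ h1⟩
  · intro he
    rw [← he, ((mem_SD_iff P i).mp hP).1] at h1
    omega
  all_goals intro he; rw [he] at h1
  · rw [h.mult_u] at h1; omega
  · rw [h.mult_v] at h1; omega
  · rw [h.mult_left] at h1; omega
  · rw [h.mult_right] at h1; omega

theorem sw_mem_SD {P : Pairing n d} {i : ℕ} (hP : P ∈ SD n d i) {u v : Fin n} {a c : Point n d}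
    (ha : OrientedGood u v P a) (h1 : mult P a.1 (P.f a).1 = 1)
    (hc : NiceBin P u v a.1 (P.f a).1 c.1) :
    sw P a c ∈ SD n d i ∧ (∀ t, mult (sw P a c) u t = mult P u t) ∧
      (∀ t, mult (sw P a c) v t = mult P v t) ∧ (sw P a c).f a = c := by
  obtain ⟨k1, k2, k3, k4, k5, k6, k7⟩ := mate_props hP hc
  have hca : c ≠ a := fun h => hc.ne_left (congrArg Prod.fst h)
  have hca' : c ≠ P.f a := fun h => hc.ne_right (congrArg Prod.fst h)
  have hm := mult_sw P hca hca'
  have hl := hc.mult_left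
  rw [mult_comm] at hl
  have key := fun s t => single_switch_mult (mult_comm P) ha.ne₅ k2 hc.ne_left hc.ne_right k5 k6 h1
    k1 hl k7 (hm s t)
  rw [mem_SD_iff] at hP ⊢
  refine ⟨⟨fun s => ?_, fun s t => ?_, ?_⟩, fun t => ?_, fun t => ?_, sw_f_left P hca⟩
  · have := key s s
    have := hP.1 s
    grind
  · have := key s t
    have := hP.2.1 s t
    grind
  · rw [← hP.2.2, edgesWithMult_eq_sum, edgesWithMult_eq_sum]
    refine Finset.sum_congr rfl fun e _ => ?_
    have := key e.1 e.2
    grind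
  · have := hm u t
    rwa [pairInd_eq_zero ha.ne₁ ha.ne₃, pairInd_eq_zero hc.ne_u k3, pairInd_eq_zero ha.ne₁ hc.ne_u,
      pairInd_eq_zero ha.ne₃ k3] at this
  · have := hm v t
    rwa [pairInd_eq_zero ha.ne₂ ha.ne₄, pairInd_eq_zero hc.ne_v k4, pairInd_eq_zero ha.ne₂ hc.ne_v,
      pairInd_eq_zero ha.ne₄ k4] at this

theorem sw_sw_mem_SD {P : Pairing n d} {i : ℕ} (hP : P ∈ SD n d i) {u v : Fin n}
    {a b c e : Point n d}
    (ha : OrientedGood u v P a) (h1 : mult P a.1 (P.f a).1 = 2)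
    (hab : a ≠ b) (hb : b.1 = a.1) (hb' : (P.f b).1 = (P.f a).1)
    (hc : NiceBin P u v a.1 (P.f a).1 c.1) (hce : c ≠ e) (he : e.1 = c.1) :
    sw (sw P a c) b e ∈ SD n d i ∧ (∀ t, mult (sw (sw P a c) b e) u t = mult P u t) ∧
      (∀ t, mult (sw (sw P a c) b e) v t = mult P v t) ∧ (sw P a c).f b = P.f b ∧
      (sw (sw P a c) b e).f a = c ∧ (sw (sw P a c) b e).f b = e := by
  have hne : NiceBin P u v a.1 (P.f a).1 e.1 := he ▸ hc
  obtain ⟨k1, k2, k3, k4, k5, k6, k7⟩ := mate_props hP hc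
  obtain ⟨l1, l2, l3, l4, l5, l6, l7⟩ := mate_props hP hne
  have fst_ne : ∀ {p q : Point n d}, p.1 ≠ q.1 → p ≠ q := fun h h' => h (congrArg Prod.fst h')
  have hca : c ≠ a := fst_ne hc.ne_left
  have hca' : c ≠ P.f a := fst_ne hc.ne_right
  have hyz : (P.f c).1 ≠ (P.f e).1 := by
    intro h
    have : 1 < mult P c.1 (P.f c).1 :=
      Finset.one_lt_card.mpr ⟨c, by simp, e, by simp [he, h], hce⟩
    omega
  have hba' : b ≠ P.f a := fst_ne (hb ▸ ha.ne₅)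
  have hbc : b ≠ c := fst_ne (hb ▸ hc.ne_left.symm)
  have hbc' : b ≠ P.f c := fst_ne (hb ▸ k5.symm)
  have hea : e ≠ a := fst_ne hne.ne_left
  have hea' : e ≠ P.f a := fst_ne hne.ne_right
  have hec' : e ≠ P.f c := fst_ne (he ▸ k2)
  have hfb : (sw P a c).f b = P.f b := sw_f_of_ne P hab.symm hba' hbc hbc'
  have hfe : (sw P a c).f e = P.f e := sw_f_of_ne P hea hea' hce.symm hec'
  have heb : e ≠ b := fst_ne (hb ▸ hne.ne_left)
  have heb' : e ≠ (sw P a c).f b := by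
    rw [hfb]
    exact fst_ne (hb' ▸ hne.ne_right)
  have hfa : (sw P a c).f a = c := sw_f_left P hca
  have hm : ∀ s t, mult (sw (sw P a c) b e) s t + 2 * pairInd a.1 (P.f a).1 s t +
      pairInd c.1 (P.f c).1 s t + pairInd c.1 (P.f e).1 s t =
      mult P s t + 2 * pairInd a.1 c.1 s t + pairInd (P.f a).1 (P.f c).1 s t +
        pairInd (P.f a).1 (P.f e).1 s t := by
    intro s t
    have h1 := mult_sw P hca hca' s t
    have h2 := mult_sw (sw P a c) heb heb' s t
    rw [hfb, hfe, hb, hb', he] at h2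
    omega
  have hl := hc.mult_left
  rw [mult_comm] at hl
  rw [he] at l1 l2
  have key := fun s t => double_switch_mult (mult_comm P) ha.ne₅ k2 hc.ne_left hc.ne_right k5 k6
    l2 l5 l6 hyz h1 k1 l1 hl k7 l7 (hm s t)
  rw [mem_SD_iff] at hP ⊢
  refine ⟨⟨fun s => ?_, fun s t => ?_, ?_⟩, fun t => ?_, fun t => ?_, hfb, ?_, sw_f_left _ heb⟩
  · have := key s s
    have := hP.1 s
    grind
  · have := key s t
    have := hP.2.1 s t
    grind
  · rw [← hP.2.2, edgesWithMult_eq_sum, edgesWithMult_eq_sum]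
    have := Finset.sum_congr (rfl : Finset.univ.filter (fun e : Fin n × Fin n => e.1 < e.2) = _)
      fun e _ => (key e.1 e.2).1
    rw [Finset.sum_add_distrib, Finset.sum_add_distrib, sum_pairInd ha.ne₅,
      sum_pairInd hc.ne_left.symm] at this
    omega
  · have := hm u t
    rwa [pairInd_eq_zero ha.ne₁ ha.ne₃, pairInd_eq_zero hc.ne_u k3, pairInd_eq_zero ha.ne₁ hc.ne_u,
      pairInd_eq_zero ha.ne₃ k3, pairInd_eq_zero hc.ne_u l3, pairInd_eq_zero ha.ne₃ l3] at this
  · have := hm v t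
    rwa [pairInd_eq_zero ha.ne₂ ha.ne₄, pairInd_eq_zero hc.ne_v k4, pairInd_eq_zero ha.ne₂ hc.ne_v,
      pairInd_eq_zero ha.ne₄ k4, pairInd_eq_zero hc.ne_v l4, pairInd_eq_zero ha.ne₄ l4] at this
  · rw [sw_f_of_ne _ hab ?_ hea.symm ?_, hfa]
    · rw [hfb]
      exact fst_ne (hb' ▸ ha.ne₅)
    · rw [hfe]
      exact fst_ne l5.symm

open Classical in
theorem card_not_niceBin_le {P : Pairing n d} {i : ℕ} (hP : P ∈ SD n d i) (u v w₁ w₂ : Fin n) :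
    (Finset.univ.filter fun x => ¬ NiceBin P u v w₁ w₂ x).card ≤ 4 + 4 * d + d * d + 2 * i := by
  rw [mem_SD_iff] at hP
  let N : Fin n → Finset (Fin n) := fun w => Finset.univ.filter fun y => 1 ≤ mult P w y
  have hN : ∀ w, (N w).card ≤ d := card_adj_le P
  let D : Finset (Fin n × Fin n) :=
    Finset.univ.filter fun q : Fin n × Fin n => q.1 < q.2 ∧ mult P q.1 q.2 = 2
  have hD : D.card = i := hP.2.2
  have hsub : (Finset.univ.filter fun x => ¬ NiceBin P u v w₁ w₂ x) ⊆
      ((({u, v, w₁, w₂} : Finset (Fin n)) ∪ ({u, v, w₁, w₂} : Finset (Fin n)).biUnion N) ∪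
        (N w₂).biUnion N) ∪ (D.image Prod.fst ∪ D.image Prod.snd) := by
    intro x hx
    by_contra hcon
    simp only [Finset.mem_union, Finset.mem_biUnion, Finset.mem_insert, Finset.mem_singleton,
      not_or, N, D, Finset.mem_filter, Finset.mem_univ, true_and, not_exists, not_and,
      Finset.mem_image, Prod.exists, exists_and_right, exists_eq_right] at hcon hx
    obtain ⟨⟨⟨⟨q1, q2, q3, q4⟩, h2⟩, h3⟩, h4, h5⟩ := hcon
    have h2' : ∀ w, (w = u ∨ w = v ∨ w = w₁ ∨ w = w₂) → mult P x w = 0 := by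
      intro w hw
      have := h2 w hw
      rw [mult_comm] at this
      omega
    refine hx ⟨q1, q2, q3, q4, h2' u (by simp), h2' v (by simp), h2' w₁ (by simp),
      h2' w₂ (by simp), fun y => ?_, fun y hy => ?_⟩
    · by_contra hcon
      have h6 : mult P x y = 2 := by
        have := hP.2.1 x y
        omega
      rcases lt_trichotomy x y with hxy | hxy | hxy
      · exact h4 y hxy h6
      · subst hxy
        rw [hP.1] at h6
        omega
      · rw [mult_comm] at h6
        exact h5 y hxy h6
    · by_contra hcon
      rw [mult_comm] at hy
      exact h3 y (by omega) hy
  have c1 : ({u, v, w₁, w₂} : Finset (Fin n)).card ≤ 4 := Finset.card_le_four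
  have c2 := Finset.card_biUnion_le_card_mul ({u, v, w₁, w₂} : Finset (Fin n)) N d fun w _ => hN w
  have c3 := Finset.card_biUnion_le_card_mul (N w₂) N d fun w _ => hN w
  have c4 : (D.image Prod.fst).card ≤ D.card := Finset.card_image_le
  have c5 : (D.image Prod.snd).card ≤ D.card := Finset.card_image_le
  have c6 := Nat.mul_le_mul_right d c1
  have c7 := Nat.mul_le_mul_right d (hN w₂)
  refine (Finset.card_le_card hsub).trans ((Finset.card_union_le _ _).trans ?_)
  have := Finset.card_union_le (({u, v, w₁, w₂} : Finset (Fin n)) ∪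
    ({u, v, w₁, w₂} : Finset (Fin n)).biUnion N) ((N w₂).biUnion N)
  have := Finset.card_union_le ({u, v, w₁, w₂} : Finset (Fin n))
    (({u, v, w₁, w₂} : Finset (Fin n)).biUnion N)
  have := Finset.card_union_le (D.image Prod.fst) (D.image Prod.snd)
  omega

/-- Points whose bin is joined to `u`. -/
def nbrPoints (P : Pairing n d) (u : Fin n) : Finset (Point n d) :=
  Finset.univ.filter fun a => 1 ≤ mult P u a.1

theorem card_nbrPoints_le (P : Pairing n d) (u : Fin n) : (nbrPoints P u).card ≤ d * d := by
  have : nbrPoints P u = (Finset.univ.filter fun y => 1 ≤ mult P u y) ×ˢ Finset.univ := by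
    ext a
    simp [nbrPoints]
  rw [this, Finset.card_product]
  simpa using Nat.mul_le_mul_right d (card_adj_le P u)

/-- Nice bins for the pair at the point `a`. -/
noncomputable def niceBins (P : Pairing n d) (u v : Fin n) (a : Point n d) : Finset (Fin n) := by
  classical exact Finset.univ.filter fun x => NiceBin P u v a.1 (P.f a).1 x

theorem mem_niceBins {P : Pairing n d} {u v : Fin n} {a : Point n d} {x : Fin n} :
    x ∈ niceBins P u v a ↔ NiceBin P u v a.1 (P.f a).1 x := by
  classical
  simp [niceBins]

theorem le_two_mul_card_niceBins {P : Pairing n d} {i : ℕ} (hP : P ∈ SD n d i)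
    (h : 2 * (4 + 4 * d + d * d + 2 * i) ≤ n) (u v : Fin n) (a : Point n d) :
    n ≤ 2 * (niceBins P u v a).card := by
  classical
  have h1 := card_not_niceBin_le hP u v a.1 (P.f a).1
  have h2 := Finset.card_filter_add_card_filter_not (s := (Finset.univ : Finset (Fin n)))
    fun x => NiceBin P u v a.1 (P.f a).1 x
  have h3 : (niceBins P u v a).card =
      (Finset.univ.filter fun x => NiceBin P u v a.1 (P.f a).1 x).card := by
    congr 1
  rw [Finset.card_univ, Fintype.card_fin] at h2
  omega

theorem card_mul_le_of_switch {α β γ δ : Type*} (A : Finset α) (T : α → Finset β) (B : Finset γ)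
    (R : γ → Finset δ) {l r : ℕ} (hl : ∀ p ∈ A, l ≤ (T p).card) (hr : ∀ Q ∈ B, (R Q).card ≤ r)
    (F : α → β → γ) (G : α → β → δ) (hF : ∀ p ∈ A, ∀ t ∈ T p, F p t ∈ B)
    (hG : ∀ p ∈ A, ∀ t ∈ T p, G p t ∈ R (F p t))
    (hinj : ∀ p ∈ A, ∀ t ∈ T p, ∀ p' ∈ A, ∀ t' ∈ T p', F p t = F p' t' → G p t = G p' t' →
      p = p' ∧ t = t') :
    A.card * l ≤ B.card * r := by
  have h1 : A.card * l ≤ (A.sigma T).card := by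
    rw [Finset.card_sigma]
    exact Finset.card_nsmul_le_sum A _ _ hl
  have h2 : (B.sigma R).card ≤ B.card * r := by
    rw [Finset.card_sigma]
    exact Finset.sum_le_card_nsmul B _ _ hr
  refine h1.trans (le_trans ?_ h2)
  refine Finset.card_le_card_of_injOn (fun q => ⟨F q.1 q.2, G q.1 q.2⟩) ?_ ?_
  · rintro ⟨p, t⟩ hq
    simp only [Finset.mem_coe, Finset.mem_sigma] at hq ⊢
    exact ⟨hF p hq.1 t hq.2, hG p hq.1 t hq.2⟩
  · rintro ⟨p, t⟩ hq ⟨p', t'⟩ hq' h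
    simp only [Finset.mem_coe, Finset.mem_sigma] at hq hq'
    simp only [Sigma.mk.injEq, heq_eq_eq] at h
    obtain ⟨h1, h2⟩ := hinj p hq.1 t hq.2 p' hq'.1 t' hq'.2 h.1 h.2
    subst h1 h2
    rfl

open Classical in
theorem card_single_le {i : ℕ} (hn : 2 * (4 + 4 * d + d * d + 2 * i) ≤ n) (u v : Fin n)
    (B : Finset (Pairing n d)) (hBS : ∀ P ∈ B, P ∈ SD n d i)
    (hB : ∀ P Q : Pairing n d, mult Q u v = mult P u v → P ∈ B → Q ∈ SD n d i → Q ∈ B) :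
    (Finset.univ.filter fun p : Pairing n d × Point n d => p.1 ∈ B ∧ OrientedGood u v p.1 p.2 ∧
      mult p.1 p.2.1 (p.1.f p.2).1 = 1).card * (n * d) ≤ B.card * (2 * (d * d * (d * d))) := by
  have key := card_mul_le_of_switch
    (Finset.univ.filter fun p : Pairing n d × Point n d => p.1 ∈ B ∧ OrientedGood u v p.1 p.2 ∧
      mult p.1 p.2.1 (p.1.f p.2).1 = 1)
    (fun p => niceBins p.1 u v p.2 ×ˢ (Finset.univ : Finset (Fin d))) B
    (fun Q => nbrPoints Q u ×ˢ nbrPoints Q v) (l := (n + 1) / 2 * d) (r := d * d * (d * d))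
    ?_ ?_ (fun p t => sw p.1 p.2 t) (fun p _ => (p.2, p.1.f p.2)) ?_ ?_ ?_
  · set A := (Finset.univ.filter fun p : Pairing n d × Point n d => p.1 ∈ B ∧
      OrientedGood u v p.1 p.2 ∧ mult p.1 p.2.1 (p.1.f p.2).1 = 1).card
    have h1 : n * d ≤ 2 * ((n + 1) / 2 * d) := by
      rw [← mul_assoc]
      exact Nat.mul_le_mul_right d (by omega)
    calc A * (n * d) ≤ A * (2 * ((n + 1) / 2 * d)) := Nat.mul_le_mul_left _ h1
      _ = 2 * (A * ((n + 1) / 2 * d)) := by ring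
      _ ≤ 2 * (B.card * (d * d * (d * d))) := Nat.mul_le_mul_left _ key
      _ = _ := by ring
  · rintro ⟨P, a⟩ hp
    simp only [Finset.mem_filter, Finset.mem_univ, true_and] at hp
    have := le_two_mul_card_niceBins (hBS P hp.1) hn u v a
    simp only [Finset.card_product, Finset.card_univ, Fintype.card_fin]
    exact Nat.mul_le_mul_right d (by omega)
  · intro Q _
    rw [Finset.card_product]
    exact Nat.mul_le_mul (card_nbrPoints_le Q u) (card_nbrPoints_le Q v)
  all_goals
    rintro ⟨P, a⟩ hp c hc
    simp only [Finset.mem_filter, Finset.mem_univ, true_and, Finset.mem_product, mem_niceBins,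
      and_true] at hp hc
    obtain ⟨h1, h2, h3, h4⟩ := sw_mem_SD (hBS P hp.1) hp.2.1 hp.2.2 hc
  · exact hB P _ (h2 v) hp.1 h1
  · simp only [Finset.mem_product, nbrPoints, Finset.mem_filter, Finset.mem_univ, true_and]
    rw [h2, h3]
    exact ⟨hp.2.1.adj_u, hp.2.1.adj_v⟩
  · rintro ⟨Q, a'⟩ hq c' hc' hF hG
    simp only [Finset.mem_filter, Finset.mem_univ, true_and, Finset.mem_product, mem_niceBins,
      and_true, Prod.mk.injEq] at hq hc' hF hG
    obtain ⟨rfl, hG⟩ := hG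
    obtain ⟨-, -, -, h4'⟩ := sw_mem_SD (hBS Q hq.1) hq.2.1 hq.2.2 hc'
    have hcc : c = c' := by rw [← h4, ← h4', hF]
    subst hcc
    unfold sw at hF
    rw [hG] at hF
    have hPQ := conj_injective _ hF
    subst hPQ
    exact ⟨rfl, rfl⟩

open Classical in
theorem card_double_le {i : ℕ} (hn : 2 * (4 + 4 * d + d * d + 2 * i) ≤ n) (u v : Fin n)
    (B : Finset (Pairing n d)) (hBS : ∀ P ∈ B, P ∈ SD n d i)
    (hB : ∀ P Q : Pairing n d, mult Q u v = mult P u v → P ∈ B → Q ∈ SD n d i → Q ∈ B) :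
    (Finset.univ.filter fun p : Pairing n d × Point n d => p.1 ∈ B ∧ OrientedGood u v p.1 p.2 ∧
      mult p.1 p.2.1 (p.1.f p.2).1 = 2).card * (n * (d * (d - 1))) ≤
      B.card * (2 * (d * d * (d * d * d))) := by
  set A : Finset (Pairing n d × Point n d × Point n d) :=
    Finset.univ.filter fun p => p.1 ∈ B ∧ OrientedGood u v p.1 p.2.1 ∧
      mult p.1 p.2.1.1 (p.1.f p.2.1).1 = 2 ∧ p.2.1 ≠ p.2.2 ∧ p.2.2.1 = p.2.1.1 ∧
      (p.1.f p.2.2).1 = (p.1.f p.2.1).1 with hA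
  have hcard : (Finset.univ.filter fun p : Pairing n d × Point n d => p.1 ∈ B ∧
      OrientedGood u v p.1 p.2 ∧ mult p.1 p.2.1 (p.1.f p.2).1 = 2).card ≤ A.card := by
    refine Finset.card_le_card_of_surjOn (fun p => (p.1, p.2.1)) ?_
    rintro ⟨P, a⟩ hp
    simp only [Finset.coe_filter, Finset.mem_univ, true_and, Set.mem_ofPred_eq] at hp
    obtain ⟨b, hb, hba⟩ := Finset.exists_mem_ne (s := Finset.univ.filter fun x : Point n d =>
      x.1 = a.1 ∧ (P.f x).1 = (P.f a).1) (show 1 < mult P _ _ by omega) a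
    simp only [Finset.mem_filter, Finset.mem_univ, true_and] at hb
    exact ⟨(P, a, b), by simpa [hA] using ⟨hp.1, hp.2.1, hp.2.2, hba.symm, hb⟩, rfl⟩
  have key := card_mul_le_of_switch A
    (fun p => niceBins p.1 u v p.2.1 ×ˢ (Finset.univ : Finset (Fin d)).offDiag) B
    (fun Q => nbrPoints Q u ×ˢ (nbrPoints Q v ×ˢ (Finset.univ : Finset (Fin d))))
    (l := (n + 1) / 2 * (d * (d - 1))) (r := d * d * (d * d * d))
    ?_ ?_ (fun p t => sw (sw p.1 p.2.1 (t.1, t.2.1)) p.2.2 (t.1, t.2.2))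
    (fun p _ => (p.2.1, p.1.f p.2.1, (p.1.f p.2.2).2)) ?_ ?_ ?_
  · have h1 : n * (d * (d - 1)) ≤ 2 * ((n + 1) / 2 * (d * (d - 1))) := by
      rw [← mul_assoc 2]
      exact Nat.mul_le_mul_right _ (by omega)
    calc _ ≤ A.card * (2 * ((n + 1) / 2 * (d * (d - 1)))) := Nat.mul_le_mul hcard h1
      _ = 2 * (A.card * ((n + 1) / 2 * (d * (d - 1)))) := by ring
      _ ≤ 2 * (B.card * (d * d * (d * d * d))) := Nat.mul_le_mul_left _ key
      _ = _ := by ring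
  · rintro ⟨P, a, b⟩ hp
    simp only [hA, Finset.mem_filter, Finset.mem_univ, true_and] at hp
    have := le_two_mul_card_niceBins (hBS P hp.1) hn u v a
    simp only [Finset.card_product, Finset.offDiag_card, Finset.card_univ, Fintype.card_fin]
    rw [Nat.mul_sub_one]
    exact Nat.mul_le_mul_right _ (by omega)
  · intro Q _
    rw [Finset.card_product, Finset.card_product, Finset.card_univ, Fintype.card_fin]
    exact Nat.mul_le_mul (card_nbrPoints_le Q u)
      (Nat.mul_le_mul_right d (card_nbrPoints_le Q v))
  all_goals
    rintro ⟨P, a, b⟩ hp ⟨x, j, k⟩ hc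
    simp only [hA, Finset.mem_filter, Finset.mem_univ, true_and, Finset.mem_product, mem_niceBins,
      Finset.mem_offDiag] at hp hc
    obtain ⟨hPB, hgood, hm, hab, hb, hb'⟩ := hp
    obtain ⟨h1, h2, h3, h4, h5, h6⟩ := sw_sw_mem_SD (c := (x, j)) (e := (x, k)) (hBS P hPB) hgood
      hm hab hb hb' hc.1 (by simpa using hc.2) rfl
  · exact hB P _ (h2 v) hPB h1
  · simp only [Finset.mem_product, nbrPoints, Finset.mem_filter, Finset.mem_univ, true_and,
      and_true]
    rw [h2, h3]
    exact ⟨hgood.adj_u, hgood.adj_v⟩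
  · rintro ⟨Q, a', b₂⟩ hq ⟨x', j', k'⟩ hc' hF hG
    simp only [hA, Finset.mem_filter, Finset.mem_univ, true_and, Finset.mem_product, mem_niceBins,
      Finset.mem_offDiag, Prod.mk.injEq] at hq hc' hF hG
    obtain ⟨hQB, hgood', hm', hab', hb₂, hb₂'⟩ := hq
    obtain ⟨rfl, hG, hG'⟩ := hG
    obtain ⟨-, -, -, h4', h5', h6'⟩ := sw_sw_mem_SD (c := (x', j')) (e := (x', k')) (hBS Q hQB)
      hgood' hm' hab' hb₂ hb₂' hc'.1 (by simpa using hc'.2) rfl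
    have hcc : (x, j) = (x', j') := by rw [← h5, ← h5', hF]
    obtain ⟨rfl, rfl⟩ := Prod.mk.inj hcc
    have hbb : b = b₂ := by
      refine eq_of_mult_le_two (sw (sw P a (x, j)) b (x, k))
        (((mem_SD_iff _ i).mp h1).2.1 a.1 x) ⟨rfl, by rw [h5]⟩ ⟨hb, by rw [h6]⟩
        ⟨hb₂, by rw [hF, h6']⟩ hab hab'
    subst hbb
    have hee : (x, k) = (x, k') := by rw [← h6, ← h6', hF]
    obtain ⟨-, rfl⟩ := Prod.mk.inj hee
    have hfb : P.f b = Q.f b := Prod.ext (by rw [hb', hb₂', hG]) hG'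
    unfold sw at hF h4 h4'
    rw [h4, h4', hfb] at hF
    have hF' := conj_injective _ hF
    rw [hG] at hF'
    have hPQ := conj_injective _ hF'
    subst hPQ
    exact ⟨rfl, rfl⟩

open Classical in
theorem card_orientedGood_mul_le {i : ℕ} (hd : 2 ≤ d)
    (hn : 2 * (4 + 4 * d + d * d + 2 * i) ≤ n) (u v : Fin n) (B : Finset (Pairing n d))
    (hBS : ∀ P ∈ B, P ∈ SD n d i)
    (hB : ∀ P Q, mult Q u v = mult P u v → P ∈ B → Q ∈ SD n d i → Q ∈ B) :
    (Finset.univ.filter fun p : Pairing n d × Point n d =>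
      p.1 ∈ B ∧ OrientedGood u v p.1 p.2).card * n ≤ B.card * (6 * d ^ 3) := by
  have h1 := card_single_le hn u v B hBS hB
  have h2 := card_double_le hn u v B hBS hB
  have hsub : (Finset.univ.filter fun p : Pairing n d × Point n d =>
      p.1 ∈ B ∧ OrientedGood u v p.1 p.2) ⊆
      (Finset.univ.filter fun p : Pairing n d × Point n d => p.1 ∈ B ∧ OrientedGood u v p.1 p.2 ∧
        mult p.1 p.2.1 (p.1.f p.2).1 = 1) ∪
      (Finset.univ.filter fun p : Pairing n d × Point n d => p.1 ∈ B ∧ OrientedGood u v p.1 p.2 ∧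
        mult p.1 p.2.1 (p.1.f p.2).1 = 2) := by
    intro p hp
    simp only [Finset.mem_filter, Finset.mem_univ, true_and, Finset.mem_union] at hp ⊢
    have := one_le_mult p.1 p.2
    have := ((mem_SD_iff p.1 i).mp (hBS _ hp.1)).2.1 p.2.1 (p.1.f p.2).1
    rcases (by omega : mult p.1 p.2.1 (p.1.f p.2).1 = 1 ∨
      mult p.1 p.2.1 (p.1.f p.2).1 = 2) with h | h
    · exact Or.inl ⟨hp.1, hp.2, h⟩
    · exact Or.inr ⟨hp.1, hp.2, h⟩
  have h3 := (Finset.card_le_card hsub).trans (Finset.card_union_le _ _)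
  revert h1 h2 h3
  generalize Finset.card (α := Pairing n d × Point n d) _ = a
  generalize Finset.card (α := Pairing n d × Point n d) _ = b
  generalize Finset.card (α := Pairing n d × Point n d) _ = c
  intro h1 h2 h3
  obtain ⟨e, rfl⟩ : ∃ e, d = e + 1 := ⟨d - 1, by omega⟩
  rw [Nat.add_sub_cancel] at h2
  have h1' : a * n ≤ B.card * (2 * (e + 1) ^ 3) := by
    refine Nat.le_of_mul_le_mul_right (?_ : _ * (e + 1) ≤ _ * (e + 1)) e.succ_pos
    linarith
  have h2' : b * n * e ≤ B.card * (2 * (e + 1) ^ 4) := by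
    refine Nat.le_of_mul_le_mul_right (?_ : _ * (e + 1) ≤ _ * (e + 1)) e.succ_pos
    linarith
  have h2'' : b * n ≤ B.card * (4 * (e + 1) ^ 3) := by
    refine Nat.le_of_mul_le_mul_right (?_ : _ * (e + 1) ≤ _ * (e + 1)) e.succ_pos
    have : b * n * (e + 1) ≤ b * n * (2 * e) := Nat.mul_le_mul_left _ (by omega)
    linarith
  have h4 := Nat.mul_le_mul_right n h3
  linarith

open Classical in
theorem card_goodPair_le (u v : Fin n) (B : Finset (Pairing n d)) :
    (Finset.univ.filter fun p : Pairing n d × Point n d => p.1 ∈ B ∧ GoodPair u v p.1 p.2).card ≤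
      2 * (Finset.univ.filter fun p : Pairing n d × Point n d =>
        p.1 ∈ B ∧ OrientedGood u v p.1 p.2).card := by
  set A := Finset.univ.filter fun p : Pairing n d × Point n d =>
    p.1 ∈ B ∧ OrientedGood u v p.1 p.2 with hA
  have hsub : (Finset.univ.filter fun p : Pairing n d × Point n d =>
      p.1 ∈ B ∧ GoodPair u v p.1 p.2) ⊆ A ∪ A.image fun p => (p.1, p.1.f p.2) := by
    rintro ⟨P, a⟩ hp
    simp only [Finset.mem_filter, Finset.mem_univ, true_and, Finset.mem_union,
      Finset.mem_image, hA] at hp ⊢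
    rcases goodPair_imp hp.2 with h | h
    · exact Or.inl ⟨hp.1, h⟩
    · exact Or.inr ⟨(P, P.f a), ⟨hp.1, h⟩, by rw [P.invol]⟩
  calc _ ≤ _ := Finset.card_le_card hsub
    _ ≤ A.card + (A.image fun p => (p.1, p.1.f p.2)).card := Finset.card_union_le _ _
    _ ≤ A.card + A.card := Nat.add_le_add_left Finset.card_image_le _
    _ = 2 * A.card := (two_mul _).symm

theorem eventually_size_bound (γ : ℝ) (hγ : 0 < γ) (d : ℕ → ℕ) (hd : ∀ n, 2 ≤ d n)
    (hdo : Filter.Tendsto (fun n : ℕ => (d n : ℝ) / Real.sqrt n) Filter.atTop (nhds 0)) :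
    ∃ n₀ : ℕ, ∀ n ≥ n₀, ∀ i ≤ i1Nat (d n) γ,
      2 * (4 + 4 * d n + d n * d n + 2 * i) ≤ n := by
  have hsq := hdo.pow 2
  rw [zero_pow two_ne_zero] at hsq
  have hK : (0 : ℝ) < 1 / (9 + γ) := by positivity
  obtain ⟨n₀, h₀⟩ := Filter.eventually_atTop.mp
    ((hsq.eventually_lt_const hK).and (Filter.eventually_gt_atTop 0))
  refine ⟨n₀, fun n hn i hi => ?_⟩
  obtain ⟨h1, hpos⟩ := h₀ n hn
  have hn' : (0 : ℝ) < n := Nat.cast_pos.mpr hpos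
  rw [div_pow, Real.sq_sqrt hn'.le, div_lt_div_iff₀ hn' (by positivity)] at h1
  have hd2 : (2 : ℝ) ≤ d n := by exact_mod_cast hd n
  have hi' : (i : ℝ) ≤ (1 + γ) * ((d n : ℝ) - 1) ^ 2 / 4 := by
    have h0 : 0 ≤ ⌊(1 + γ) * ((d n : ℝ) - 1) ^ 2 / 4⌋ := Int.floor_nonneg.mpr (by positivity)
    have : (i : ℤ) ≤ ⌊(1 + γ) * ((d n : ℝ) - 1) ^ 2 / 4⌋ := by
      rw [← Int.toNat_of_nonneg h0]
      exact Int.ofNat_le.mpr hi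
    exact_mod_cast Int.le_floor.mp this
  have hi'' : 4 * (i : ℝ) ≤ (1 + γ) * (d n : ℝ) ^ 2 := by nlinarith
  have : (2 * (4 + 4 * d n + d n * d n + 2 * i) : ℝ) ≤ n := by nlinarith
  exact_mod_cast this

/-- Lemma 7: for `P` uniformly random in `{P ∈ S_i : E}` (where `E` fixes the
status of the edge `uv`) and `x` a uniformly random pair of `P`, the
probability that one endpoint of `x` lies in a bin adjacent to `u` and the
other in a bin adjacent to `v` (all four bins being distinct) is `O(d²/n²)`. -/
theorem stmt_6 (γ : ℝ) (hγ : 0 < γ) (d : ℕ → ℕ) (hd : ∀ n, 2 ≤ d n)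
    (hdo : Filter.Tendsto (fun n : ℕ => (d n : ℝ) / Real.sqrt n) Filter.atTop
      (nhds 0)) :
    ∃ C : ℝ, 0 < C ∧ ∃ n0 : ℕ, ∀ n : ℕ, n0 ≤ n → Even (d n * n) →
      ∀ i : ℕ, i ≤ i1Nat (d n) γ → ∀ u v : Fin n, u ≠ v →
      ∀ E : Pairing n (d n) → Prop,
        ((∀ P, E P ↔ mult P u v = 1) ∨ (∀ P, E P ↔ mult P u v = 2) ∨
          (∀ P, E P ↔ ¬ Adj P u v)) →
        (∃ P, P ∈ SD n (d n) i ∧ E P) →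
        (Nat.card {q : Pairing n (d n) × Point n (d n) //
              q.1 ∈ SD n (d n) i ∧ E q.1 ∧ GoodPair u v q.1 q.2} : ℝ) /
            ((Nat.card {P : Pairing n (d n) // P ∈ SD n (d n) i ∧ E P} : ℝ) *
              ((d n : ℝ) * n))
          ≤ C * (d n : ℝ) ^ 2 / (n : ℝ) ^ 2 := by
  obtain ⟨n₀, h₀⟩ := eventually_size_bound γ hγ d hd hdo
  refine ⟨12, by norm_num, n₀, fun n hn _ i hi u v huv E hE hne => ?_⟩
  classical
  have hsize := h₀ n hn i hi
  set B : Finset (Pairing n (d n)) := Finset.univ.filter fun P => P ∈ SD n (d n) i ∧ E P with hBdef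
  have hmem : ∀ P, P ∈ B ↔ P ∈ SD n (d n) i ∧ E P := fun P => by simp [hBdef]
  have hE' : ∀ P Q, mult Q u v = mult P u v → E P → E Q := by
    intro P Q h
    rcases hE with hE | hE | hE
    · rw [hE, hE, h]; exact id
    · rw [hE, hE, h]; exact id
    · rw [hE, hE, Adj, Adj, h]; exact id
  have hcard := card_orientedGood_mul_le (hd n) hsize u v B (fun P hP => ((hmem P).mp hP).1)
    fun P Q h hP hQ => (hmem Q).mpr ⟨hQ, hE' P Q h ((hmem P).mp hP).2⟩
  have hgood := card_goodPair_le u v B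
  have hB : Nat.card {P : Pairing n (d n) // P ∈ SD n (d n) i ∧ E P} = B.card := by
    rw [Nat.card_eq_fintype_card, Fintype.card_subtype]
  have hG : Nat.card {q : Pairing n (d n) × Point n (d n) //
      q.1 ∈ SD n (d n) i ∧ E q.1 ∧ GoodPair u v q.1 q.2} =
      (Finset.univ.filter fun p : Pairing n (d n) × Point n (d n) =>
        p.1 ∈ B ∧ GoodPair u v p.1 p.2).card := by
    rw [Nat.card_eq_fintype_card, Fintype.card_subtype]
    congr 1
    ext q
    simp only [Finset.mem_filter, hmem, and_assoc]
  have hBpos : 0 < B.card := by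
    obtain ⟨P, hP⟩ := hne
    exact Finset.card_pos.mpr ⟨P, (hmem P).mpr hP⟩
  rw [hG, hB]
  have hfin := (Nat.mul_le_mul_right n hgood).trans
    ((mul_assoc _ _ _).le.trans (Nat.mul_le_mul_left 2 hcard))
  generalize Finset.card (α := Pairing n (d n) × Point n (d n)) _ = g at hfin ⊢
  have hfin' : (g : ℝ) * n ≤ 2 * (B.card * (6 * (d n : ℝ) ^ 3)) := by exact_mod_cast hfin
  have hn0 : (0 : ℝ) < n := by exact_mod_cast (by omega : 0 < n)
  have hd0 : (0 : ℝ) < d n := by exact_mod_cast (by linarith [hd n] : 0 < d n)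
  have hB0 : (0 : ℝ) < B.card := by exact_mod_cast hBpos
  rw [div_le_div_iff₀ (by positivity) (by positivity)]
  calc (g : ℝ) * (n : ℝ) ^ 2 = g * n * n := by ring
    _ ≤ 2 * (B.card * (6 * (d n : ℝ) ^ 3)) * n := by gcongr
    _ = 12 * (d n : ℝ) ^ 2 * (B.card * (d n * n)) := by ring

end Reg
end
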